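/- arXiv:1306.2109 — 7 statements merged into one kernel-verified Lean document; each statement's English description precedes it below -/
import Mathlib

section
/- Let N ≥ 2 be an integer and let n be an integer with 1 ≤ n ≤ N − 1. For a real number K > 0 define s(K) = (n^{NK} + (N−n)^{NK}) / (n^K + (N−n)^K)^N. Then s(K+1) ≥ s(K), with equality if and only if 2n = N. -/
theorem pow_add_pow_lt_of_add_eq {N : ℕ} (hN : 2 ≤ N) {u v x y : ℝ} (hu : 0 ≤ u)
    (hux : u < x) (hxv : x < v) (h : x + y = u + v) :
    x ^ N + y ^ N < u ^ N + v ^ N := by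
  have hc := (strictConvexOn_pow hN).2
  have huv : u < v := hux.trans hxv
  have hd : 0 < v - u := sub_pos.2 huv
  have hs : 0 < (v - x) / (v - u) := div_pos (sub_pos.2 hxv) hd
  have ht : 0 < (x - u) / (v - u) := div_pos (sub_pos.2 hux) hd
  have hst : (v - x) / (v - u) + (x - u) / (v - u) = 1 := by field_simp; ring
  have hx : (v - x) / (v - u) * u + (x - u) / (v - u) * v = x := by field_simp; ring
  have hy : (x - u) / (v - u) * u + (v - x) / (v - u) * v = y := by
    have : y = u + v - x := by linarith
    subst this
    field_simp
    ring
  have h1 := hc (Set.mem_Ici.2 hu) (Set.mem_Ici.2 (hu.trans huv.le)) huv.ne hs ht hst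
  have h2 := hc (Set.mem_Ici.2 hu) (Set.mem_Ici.2 (hu.trans huv.le)) huv.ne ht hs
    (by rw [add_comm, hst])
  simp only [smul_eq_mul, hx] at h1
  simp only [smul_eq_mul, hy] at h2
  have ht' : (x - u) / (v - u) = 1 - (v - x) / (v - u) := by linarith
  rw [ht'] at h1 h2
  linarith

theorem rpow_mul_add_div_eq (N : ℕ) {c d : ℝ} (hc : 0 < c) (hd : 0 < d) (K : ℝ) :
    (c ^ ((N : ℝ) * K) + d ^ ((N : ℝ) * K)) / (c ^ K + d ^ K) ^ (N : ℝ) =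
      (c ^ K / (c ^ K + d ^ K)) ^ N + (d ^ K / (c ^ K + d ^ K)) ^ N := by
  rw [mul_comm, Real.rpow_mul hc.le, Real.rpow_mul hd.le]
  simp only [Real.rpow_natCast, div_pow, add_div]

theorem rpow_mul_add_div_lt {N : ℕ} (hN : 2 ≤ N) {c d : ℝ} (hc : 0 < c) (hcd : c < d)
    {K : ℝ} (hK : 0 < K) :
    (c ^ ((N : ℝ) * K) + d ^ ((N : ℝ) * K)) / (c ^ K + d ^ K) ^ (N : ℝ) <
      (c ^ ((N : ℝ) * (K + 1)) + d ^ ((N : ℝ) * (K + 1))) /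
        (c ^ (K + 1) + d ^ (K + 1)) ^ (N : ℝ) := by
  have hd : 0 < d := hc.trans hcd
  rw [rpow_mul_add_div_eq N hc hd, rpow_mul_add_div_eq N hc hd,
    Real.rpow_add_one hc.ne', Real.rpow_add_one hd.ne']
  have ha : 0 < c ^ K := Real.rpow_pos_of_pos hc K
  have hab : c ^ K < d ^ K := Real.rpow_lt_rpow hc.le hcd hK
  generalize c ^ K = a at *
  generalize d ^ K = b at *
  have hb : 0 < b := ha.trans hab
  have habcd : a * c < b * d := mul_lt_mul hab hcd.le hc hb.le
  refine pow_add_pow_lt_of_add_eq hN (by positivity) ?_ ?_ ?_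
  · rw [div_lt_div_iff₀ (by positivity) (by positivity)]
    nlinarith [mul_pos (mul_pos ha hb) (sub_pos.2 hcd)]
  · rw [div_lt_div_iff₀ (by positivity) (by positivity)]
    nlinarith [mul_lt_mul_of_pos_left habcd ha, mul_pos (mul_pos hb hd) (sub_pos.2 hab)]
  · field_simp

/-- For an integer `N ≥ 2`, an integer `n` with `1 ≤ n ≤ N - 1`, and
`s(K) = (n^(NK) + (N-n)^(NK)) / (n^K + (N-n)^K)^N` (real powers), one has
`s(K+1) ≥ s(K)` for every real `K > 0`, with equality iff `2n = N`. -/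
theorem stmt_1 (N n : ℕ) (hN : 2 ≤ N) (hn1 : 1 ≤ n) (hn2 : n ≤ N - 1)
    (s : ℝ → ℝ)
    (hs : ∀ K : ℝ, s K =
      ((n : ℝ) ^ ((N : ℝ) * K) + ((N : ℝ) - (n : ℝ)) ^ ((N : ℝ) * K)) /
        ((n : ℝ) ^ K + ((N : ℝ) - (n : ℝ)) ^ K) ^ (N : ℝ))
    (K : ℝ) (hK : 0 < K) :
    s K ≤ s (K + 1) ∧ (s (K + 1) = s K ↔ 2 * n = N) := by
  have hn : (0 : ℝ) < n := by exact_mod_cast hn1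
  have hm : (0 : ℝ) < (N : ℝ) - n := sub_pos.2 (by exact_mod_cast (by omega : n < N))
  have hne : (2 * n = N) ↔ (n : ℝ) = N - n := by
    rw [eq_sub_iff_add_eq, ← two_mul]
    exact_mod_cast Iff.rfl
  rw [hne, hs, hs]
  generalize (N : ℝ) - n = m at *
  rcases lt_trichotomy (n : ℝ) m with h | h | h
  · have := rpow_mul_add_div_lt hN hn h hK
    exact ⟨this.le, iff_of_false this.ne' h.ne⟩
  · subst h
    have key : ∀ L : ℝ, ((n : ℝ) ^ ((N : ℝ) * L) + (n : ℝ) ^ ((N : ℝ) * L)) /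
        ((n : ℝ) ^ L + (n : ℝ) ^ L) ^ (N : ℝ) = (1 / 2) ^ N + (1 / 2) ^ N := by
      intro L
      have hL : (n : ℝ) ^ L ≠ 0 := (Real.rpow_pos_of_pos hn L).ne'
      have half : (n : ℝ) ^ L / ((n : ℝ) ^ L + (n : ℝ) ^ L) = 1 / 2 := by
        rw [← two_mul]
        field_simp
      rw [rpow_mul_add_div_eq N hn hn, half]
    rw [key, key]
    exact ⟨le_rfl, iff_of_true rfl rfl⟩
  · have := rpow_mul_add_div_lt hN hm h hK
    simp only [add_comm (m ^ (_ : ℝ))] at this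
    exact ⟨this.le, iff_of_false this.ne' h.ne'⟩
end

section
/- Let N > 2 be an integer. For each positive integer K and each n ∈ {1, …, N−1}, let q_n(K) = n^K / (n^K + (N−n)^K), and let Q(K) be the (N−1)×(N−1) real matrix with entries Q(K)_{n,m} = C(N,m) · q_n(K)^m · (1 − q_n(K))^{N−m} for n, m ∈ {1, …, N−1}, where C(N,m) is the binomial coefficient. Then all entries of Q(K) are strictly positive, and the spectral radius of Q(K) is strictly decreasing in K: ρ(Q(K+1)) < ρ(Q(K)). -/
open Polynomial

/-- The expectation of `V` under the binomial distribution with parameter `x`, as a polynomial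
in `x`. -/
noncomputable def binomialMean (N : ℕ) (V : ℕ → ℝ) : ℝ[X] :=
  ∑ m ∈ Finset.range (N + 1), C (V m) * bernsteinPolynomial ℝ N m

lemma binomialMean_eval (N : ℕ) (V : ℕ → ℝ) (x : ℝ) :
    (binomialMean N V).eval x =
      ∑ m ∈ Finset.range (N + 1), (N.choose m : ℝ) * x ^ m * (1 - x) ^ (N - m) * V m := by
  simp only [binomialMean, eval_finsetSum, bernsteinPolynomial, eval_mul, eval_C, eval_pow,
    eval_X, eval_sub, eval_one, eval_natCast]
  exact Finset.sum_congr rfl fun m _ => by ring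

lemma binomialMean_derivative (M : ℕ) (V : ℕ → ℝ) :
    derivative (binomialMean (M + 1) V) =
      (M + 1 : ℝ[X]) * binomialMean M (fun k => V (k + 1) - V k) := by
  have h0 : bernsteinPolynomial ℝ M (M + 1) = 0 := by simp [bernsteinPolynomial]
  have h1 : ∑ k ∈ Finset.range (M + 1), C (V (k + 1)) * bernsteinPolynomial ℝ M (k + 1)
      = ∑ k ∈ Finset.range (M + 1), C (V k) * bernsteinPolynomial ℝ M k
        - C (V 0) * bernsteinPolynomial ℝ M 0 := by
    rw [Finset.sum_range_succ, h0, mul_zero, add_zero, Finset.sum_range_succ' _ M]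
    ring
  rw [binomialMean, binomialMean, derivative_sum, Finset.sum_range_succ']
  simp only [derivative_mul, derivative_C, zero_mul, zero_add,
    bernsteinPolynomial.derivative_succ, bernsteinPolynomial.derivative_zero, C_sub, sub_mul,
    mul_sub, Finset.sum_sub_distrib, Nat.add_sub_cancel, Nat.cast_add, Nat.cast_one]
  simp only [mul_left_comm (C _) (_ + _ : ℝ[X]), ← Finset.mul_sum, h1]
  ring

lemma binomialMean_eval_one_sub (N : ℕ) (V : ℕ → ℝ) (hV : ∀ n ≤ N, V (N - n) = V n) (x : ℝ) :
    (binomialMean N V).eval (1 - x) = (binomialMean N V).eval x := by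
  rw [binomialMean_eval, binomialMean_eval, ← Finset.sum_range_reflect]
  refine Finset.sum_congr rfl fun m hm => ?_
  have hm : m ≤ N := by simpa [Nat.lt_succ_iff] using hm
  rw [show N + 1 - 1 - m = N - m by omega, Nat.choose_symm hm, Nat.sub_sub_self hm, hV m hm]
  ring

lemma pow_mul_pow_swap_le {x y : ℝ} (hx : 0 ≤ x) (hxy : x ≤ y) {a b : ℕ} (hab : a ≤ b) :
    x ^ b * y ^ a ≤ x ^ a * y ^ b := by
  obtain ⟨c, rfl⟩ := Nat.exists_eq_add_of_le hab
  have : 0 ≤ x ^ a * y ^ a := by have := hx.trans hxy; positivity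
  calc x ^ (a + c) * y ^ a = x ^ a * y ^ a * x ^ c := by ring
    _ ≤ x ^ a * y ^ a * y ^ c := by gcongr
    _ = _ := by ring

/-- Nonnegative, symmetric about `N / 2`, and nondecreasing up to `N / 2`. -/
structure SymmUnimodal (N : ℕ) (V : ℕ → ℝ) : Prop where
  nonneg : ∀ n, 0 ≤ V n
  symm : ∀ n ≤ N, V (N - n) = V n
  mono : ∀ n, 2 * (n + 1) ≤ N → V n ≤ V (n + 1)

lemma SymmUnimodal.le_two_mul_derivative {M : ℕ} {V : ℕ → ℝ} (hV : SymmUnimodal (M + 1) V)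
    {x : ℝ} (hx0 : 0 ≤ x) (hx : x ≤ 1 / 2) :
    (M + 1) * (((1 - x) ^ M - x ^ M) * (V 1 - V 0)) ≤
      2 * (derivative (binomialMean (M + 1) V)).eval x := by
  set d : ℕ → ℝ := fun k => V (k + 1) - V k
  have hd : ∀ k ≤ M, d (M - k) = - d k := fun k hk => by
    have h1 := hV.symm k (by omega)
    have h2 := hV.symm (k + 1) (by omega)
    rw [show M + 1 - k = M - k + 1 by omega] at h1
    rw [show M + 1 - (k + 1) = M - k by omega] at h2
    simp only [d, h1, h2]; ring
  have hd0 : ∀ k, 2 * k < M → 0 ≤ d k := fun k hk => sub_nonneg.2 (hV.mono k (by omega))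
  set t : ℕ → ℝ := fun k =>
    (M.choose k : ℝ) * (x ^ k * (1 - x) ^ (M - k) - x ^ (M - k) * (1 - x) ^ k) * d k
  have hsum : 2 * (binomialMean M d).eval x = ∑ k ∈ Finset.range (M + 1), t k := by
    rw [two_mul]
    nth_rewrite 2 [binomialMean_eval]
    rw [← Finset.sum_range_reflect, binomialMean_eval, ← Finset.sum_add_distrib]
    refine Finset.sum_congr rfl fun k hk => ?_
    have hk : k ≤ M := by simpa [Nat.lt_succ_iff] using hk
    rw [show M + 1 - 1 - k = M - k by omega, Nat.choose_symm hk, Nat.sub_sub_self hk, hd k hk]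
    simp only [t]; ring
  have ht : ∀ k ∈ Finset.range (M + 1), 0 ≤ t k := fun k hk => by
    have hk : k ≤ M := by simpa [Nat.lt_succ_iff] using hk
    rcases lt_trichotomy (2 * k) M with h | h | h
    · have := pow_mul_pow_swap_le hx0 (by linarith : x ≤ 1 - x) (by omega : k ≤ M - k)
      exact mul_nonneg (mul_nonneg (by positivity) (sub_nonneg.2 this)) (hd0 k h)
    · simp [t, show M - k = k by omega]
    · have := pow_mul_pow_swap_le hx0 (by linarith : x ≤ 1 - x) (by omega : M - k ≤ k)
      have h2 := hd0 (M - k) (by omega)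
      rw [hd k hk] at h2
      exact mul_nonneg_of_nonpos_of_nonpos
        (mul_nonpos_of_nonneg_of_nonpos (by positivity) (sub_nonpos.2 this)) (by linarith)
  have h0 := Finset.single_le_sum ht (Finset.mem_range.2 M.succ_pos)
  rw [← hsum] at h0
  simp only [t, d, Nat.choose_zero_right, Nat.cast_one, pow_zero, Nat.sub_zero, one_mul,
    mul_one, zero_add] at h0
  rw [binomialMean_derivative, eval_mul]
  simp only [eval_add, eval_natCast, eval_one]
  have := mul_le_mul_of_nonneg_left h0 (by positivity : (0:ℝ) ≤ M + 1)
  linarith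

lemma SymmUnimodal.monotoneOn {M : ℕ} {V : ℕ → ℝ} (hV : SymmUnimodal (M + 1) V)
    (h01 : V 0 ≤ V 1) :
    MonotoneOn (fun x => (binomialMean (M + 1) V).eval x) (Set.Icc 0 (1 / 2)) := by
  refine monotoneOn_of_deriv_nonneg (convex_Icc _ _) (Polynomial.continuous _).continuousOn
    (Polynomial.differentiable _).differentiableOn fun x hx => ?_
  rw [interior_Icc] at hx
  rw [Polynomial.deriv]
  have h := hV.le_two_mul_derivative hx.1.le hx.2.le
  have : x ^ M ≤ (1 - x) ^ M := pow_le_pow_left₀ hx.1.le (by linarith [hx.2]) _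
  have : 0 ≤ (M + 1) * (((1 - x) ^ M - x ^ M) * (V 1 - V 0)) :=
    mul_nonneg (by positivity) (mul_nonneg (by linarith) (by linarith))
  linarith

lemma SymmUnimodal.strictMonoOn {M : ℕ} (hM : M ≠ 0) {V : ℕ → ℝ}
    (hV : SymmUnimodal (M + 1) V) (h01 : V 0 < V 1) :
    StrictMonoOn (fun x => (binomialMean (M + 1) V).eval x) (Set.Icc 0 (1 / 2)) := by
  refine strictMonoOn_of_deriv_pos (convex_Icc _ _) (Polynomial.continuous _).continuousOn
    fun x hx => ?_
  rw [interior_Icc] at hx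
  rw [Polynomial.deriv]
  have h := hV.le_two_mul_derivative hx.1.le hx.2.le
  have : x ^ M < (1 - x) ^ M := pow_lt_pow_left₀ (by linarith [hx.2]) hx.1.le hM
  have : 0 < (M + 1) * (((1 - x) ^ M - x ^ M) * (V 1 - V 0)) :=
    mul_pos (by positivity) (mul_pos (by linarith) (by linarith))
  linarith

section Perron

variable {ι : Type*} [Fintype ι]

lemma Matrix.mulVec_pos_of_pos {A : Matrix ι ι ℝ} (hA : ∀ i j, 0 < A i j) {v : ι → ℝ}
    (hv : 0 ≤ v) (hv0 : v ≠ 0) (i : ι) : 0 < A.mulVec v i := by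
  obtain ⟨j, hj⟩ := Function.ne_iff.1 hv0
  exact Finset.sum_pos' (fun k _ => mul_nonneg (hA i k).le (hv k))
    ⟨j, Finset.mem_univ _, mul_pos (hA i j) (lt_of_le_of_ne (hv j) (Ne.symm hj))⟩

lemma exists_lt_mul_of_forall_lt [Nonempty ι] {u w : ι → ℝ} {c : ℝ} (hw : ∀ i, 0 < w i)
    (h : ∀ i, u i < c * w i) : ∃ μ < c, ∀ i, u i ≤ μ * w i := by
  obtain ⟨i, hi⟩ := Finite.exists_max fun i => u i / w i
  exact ⟨u i / w i, (div_lt_iff₀ (hw i)).2 (h i), fun j => (div_le_iff₀ (hw j)).1 (hi j)⟩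

/-- A positive matrix preserving a closed cone of nonnegative vectors has a positive
eigenvector in that cone. -/
lemma Matrix.exists_pos_eigenvector_mem [Nonempty ι] {A : Matrix ι ι ℝ} (hA : ∀ i j, 0 < A i j)
    {S : Set (ι → ℝ)} (hS : IsClosed S) (hS0 : ∀ v ∈ S, 0 ≤ v)
    (hsmul : ∀ v ∈ S, ∀ c : ℝ, 0 < c → c • v ∈ S) (hAS : ∀ v ∈ S, A.mulVec v ∈ S)
    {u : ι → ℝ} (hu : u ∈ S) (hu0 : u ≠ 0) :
    ∃ v ∈ S, ∃ c : ℝ, (∀ i, 0 < v i) ∧ A.mulVec v = c • v := by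
  have hsum : ∀ v ∈ S, v ≠ 0 → 0 < ∑ i, v i := fun v hv hv0 => by
    obtain ⟨j, hj⟩ := Function.ne_iff.1 hv0
    exact Finset.sum_pos' (fun k _ => hS0 v hv k)
      ⟨j, Finset.mem_univ _, lt_of_le_of_ne (hS0 v hv j) (Ne.symm hj)⟩
  set b := ∑ i, ∑ j, A i j
  let T : Set (ℝ × (ι → ℝ)) := (Set.Icc 0 b ×ˢ Set.Icc 0 1) ∩
    {p | p.2 ∈ S ∧ ∑ i, p.2 i = 1 ∧ ∀ i, p.1 * p.2 i ≤ A.mulVec p.2 i}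
  have hT : IsCompact T := by
    refine (isCompact_Icc.prod isCompact_Icc).inter_right ?_
    refine (hS.preimage continuous_snd).inter (IsClosed.inter ?_ ?_)
    · exact isClosed_eq (by fun_prop) continuous_const
    · have : IsClosed (⋂ i, {p : ℝ × (ι → ℝ) | p.1 * p.2 i ≤ A.mulVec p.2 i}) :=
        isClosed_iInter fun i => isClosed_le (by fun_prop) (by
          simp only [Matrix.mulVec, dotProduct]; fun_prop)
      rwa [← Set.ofPred_forall] at this
  have hmem : ∀ c : ℝ, ∀ v ∈ S, 0 ≤ c → v ≠ 0 → (∀ i, c * v i ≤ A.mulVec v i) →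
      ∃ w, (c, w) ∈ T := by
    intro c v hv hc hv0 h
    have hs := hsum v hv hv0
    set s := ∑ i, v i
    have hw := hsmul v hv s⁻¹ (by positivity)
    have hw1 : ∑ i, (s⁻¹ • v) i = 1 := by
      simp only [Pi.smul_apply, smul_eq_mul, ← Finset.mul_sum]
      exact inv_mul_cancel₀ hs.ne'
    have hle1 : ∀ i, (s⁻¹ • v) i ≤ 1 := fun i => by
      rw [← hw1]
      exact Finset.single_le_sum (f := s⁻¹ • v) (fun k _ => hS0 _ hw k) (Finset.mem_univ i)
    have hcw : ∀ i, c * (s⁻¹ • v) i ≤ A.mulVec (s⁻¹ • v) i := fun i => by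
      rw [Matrix.mulVec_smul]
      simp only [Pi.smul_apply, smul_eq_mul]
      rw [mul_left_comm]
      exact mul_le_mul_of_nonneg_left (h i) (by positivity)
    refine ⟨s⁻¹ • v, ⟨⟨⟨hc, ?_⟩, hS0 _ hw, hle1⟩, hw, hw1, hcw⟩⟩
    calc c = ∑ i, c * (s⁻¹ • v) i := by rw [← Finset.mul_sum, hw1, mul_one]
      _ ≤ ∑ i, A.mulVec (s⁻¹ • v) i := Finset.sum_le_sum fun i _ => hcw i
      _ ≤ b := Finset.sum_le_sum fun i _ => Finset.sum_le_sum fun j _ =>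
          mul_le_of_le_one_right (hA i j).le (hle1 j)
  obtain ⟨w₀, hw₀⟩ := hmem 0 u hu le_rfl hu0 fun i => by
    rw [zero_mul]; exact (Matrix.mulVec_pos_of_pos hA (hS0 u hu) hu0 i).le
  obtain ⟨⟨c, v⟩, ⟨⟨⟨hc0, -⟩, -⟩, hvS, hv1, hcv⟩, hmax⟩ :=
    hT.exists_isMaxOn ⟨_, hw₀⟩ continuous_fst.continuousOn
  dsimp only at hc0 hvS hv1 hcv
  have hv0 : v ≠ 0 := by rintro rfl; simp at hv1
  have hAv := Matrix.mulVec_pos_of_pos hA (hS0 v hvS) hv0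
  have heq : A.mulVec v = c • v := by
    by_contra hne
    have hpos := Matrix.mulVec_pos_of_pos hA (v := A.mulVec v - c • v)
      (fun i => by simpa using hcv i) (sub_ne_zero.2 hne)
    obtain ⟨μ, hμ, hμle⟩ := exists_lt_mul_of_forall_lt (u := fun i => -A.mulVec (A.mulVec v) i)
      (c := -c) hAv fun i => by
        have := hpos i
        simp only [Matrix.mulVec_sub, Matrix.mulVec_smul, Pi.sub_apply, Pi.smul_apply,
          smul_eq_mul] at this
        linarith
    obtain ⟨w, hw⟩ := hmem (-μ) (A.mulVec v) (hAS v hvS) (by linarith)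
      (fun h => by obtain ⟨i⟩ := ‹Nonempty ι›; exact (hAv i).ne' (congrFun h i))
      fun i => by linarith [hμle i]
    have := hmax hw
    simp only [Set.mem_ofPred_eq] at this
    linarith
  refine ⟨v, hvS, c, fun i => lt_of_le_of_ne (hS0 v hvS i) fun h => ?_, heq⟩
  have := hAv i
  rw [heq, Pi.smul_apply, ← h, smul_zero] at this
  exact lt_irrefl _ this

variable [DecidableEq ι]

lemma Matrix.mem_spectrum_iff_exists_mulVec {A : Matrix ι ι ℂ} {z : ℂ} :
    z ∈ spectrum ℂ A ↔ ∃ x ≠ 0, A.mulVec x = z • x := by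
  rw [← Matrix.spectrum_toLin', ← Module.End.hasEigenvalue_iff_mem_spectrum]
  constructor
  · intro h
    obtain ⟨x, hx⟩ := h.exists_hasEigenvector
    exact ⟨x, hx.2, by simpa using hx.apply_eq_smul⟩
  · rintro ⟨x, hx, h⟩
    exact Module.End.hasEigenvalue_of_hasEigenvector
      ⟨Module.End.mem_eigenspace_iff.2 (by simpa using h), hx⟩

lemma Matrix.spectralRadius_le_of_mulVec_le [Nonempty ι] {A : Matrix ι ι ℝ}
    (hA : ∀ i j, 0 ≤ A i j) {w : ι → ℝ} (hw : ∀ i, 0 < w i) {μ : ℝ}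
    (h : ∀ i, A.mulVec w i ≤ μ * w i) :
    spectralRadius ℂ (A.map Complex.ofReal) ≤ ENNReal.ofReal μ := by
  refine iSup₂_le fun z hz => ?_
  obtain ⟨x, hx0, hx⟩ := Matrix.mem_spectrum_iff_exists_mulVec.1 hz
  rw [← ENNReal.ofReal_coe_nnreal, coe_nnnorm]
  refine ENNReal.ofReal_le_ofReal ?_
  obtain ⟨i, hi⟩ := Finite.exists_max fun i => ‖x i‖ / w i
  set t := ‖x i‖ / w i
  have hle : ∀ j, ‖x j‖ ≤ t * w j := fun j => (div_le_iff₀ (hw j)).1 (hi j)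
  have hxi : ‖x i‖ = t * w i := (div_mul_cancel₀ _ (hw i).ne').symm
  have ht : 0 < t := by
    obtain ⟨j, hj⟩ := Function.ne_iff.1 hx0
    exact (div_pos (norm_pos_iff.2 hj) (hw j)).trans_le (hi j)
  have hxp : 0 < ‖x i‖ := by rw [hxi]; exact mul_pos ht (hw i)
  refine le_of_mul_le_mul_right ?_ hxp
  calc ‖z‖ * ‖x i‖ = ‖(A.map Complex.ofReal).mulVec x i‖ := by
        rw [hx, Pi.smul_apply, smul_eq_mul, norm_mul]
    _ ≤ ∑ j, ‖(A i j : ℂ) * x j‖ := norm_sum_le _ _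
    _ ≤ ∑ j, t * (A i j * w j) := Finset.sum_le_sum fun j _ => by
        rw [norm_mul, Complex.norm_real, Real.norm_of_nonneg (hA i j), mul_left_comm]
        exact mul_le_mul_of_nonneg_left (hle j) (hA i j)
    _ = t * A.mulVec w i := by rw [← Finset.mul_sum]; rfl
    _ ≤ t * (μ * w i) := mul_le_mul_of_nonneg_left (h i) ht.le
    _ = μ * ‖x i‖ := by rw [hxi]; ring

lemma Matrix.ofReal_le_spectralRadius {A : Matrix ι ι ℝ} {v : ι → ℝ} (hv : v ≠ 0) {c : ℝ}
    (h : A.mulVec v = c • v) :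
    ENNReal.ofReal c ≤ spectralRadius ℂ (A.map Complex.ofReal) := by
  have hmem : (c : ℂ) ∈ spectrum ℂ (A.map Complex.ofReal) := by
    refine Matrix.mem_spectrum_iff_exists_mulVec.2 ⟨fun i => (v i : ℂ), fun h0 => hv ?_, ?_⟩
    · ext i; simpa using congrFun h0 i
    · ext i
      have := congrArg Complex.ofReal (congrFun h i)
      simpa [Matrix.mulVec, dotProduct] using this
  refine le_trans ?_ (le_iSup₂ (f := fun z (_ : z ∈ spectrum ℂ (A.map Complex.ofReal)) =>
    (‖z‖₊ : ENNReal)) (c : ℂ) hmem)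
  rw [← ENNReal.ofReal_coe_nnreal, coe_nnnorm, Complex.norm_real]
  exact ENNReal.ofReal_le_ofReal (le_abs_self c)

/-- Strict comparison of spectral radii of positive matrices from a common subinvariant vector. -/
lemma Matrix.spectralRadius_lt_of_mulVec_le [Nonempty ι] {A B : Matrix ι ι ℝ}
    (hB : ∀ i j, 0 < B i j) {v : ι → ℝ} (hv : ∀ i, 0 < v i) {c : ℝ}
    (hAv : A.mulVec v = c • v) (hle : ∀ i, B.mulVec v i ≤ A.mulVec v i)
    (hlt : ∃ i, B.mulVec v i < A.mulVec v i) :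
    spectralRadius ℂ (B.map Complex.ofReal) < spectralRadius ℂ (A.map Complex.ofReal) := by
  have hv0 : v ≠ 0 := by
    obtain ⟨i⟩ := ‹Nonempty ι›
    exact fun h => (hv i).ne' (congrFun h i)
  have hBv := Matrix.mulVec_pos_of_pos hB (fun i => (hv i).le) hv0
  have hne : A.mulVec v - B.mulVec v ≠ 0 := by
    obtain ⟨i, hi⟩ := hlt
    exact fun h => (sub_pos.2 hi).ne' (congrFun h i)
  have hpos := Matrix.mulVec_pos_of_pos hB (v := A.mulVec v - B.mulVec v)
    (fun i => sub_nonneg.2 (hle i)) hne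
  obtain ⟨μ, hμ, hμle⟩ := exists_lt_mul_of_forall_lt (u := B.mulVec (B.mulVec v)) (c := c) hBv
    fun i => by
      have := hpos i
      simp only [hAv, Matrix.mulVec_sub, Matrix.mulVec_smul, Pi.sub_apply, Pi.smul_apply,
        smul_eq_mul] at this
      linarith
  have hc : 0 < c := by
    obtain ⟨i⟩ := ‹Nonempty ι›
    have := (hBv i).trans_le (hle i)
    rw [hAv, Pi.smul_apply, smul_eq_mul] at this
    exact pos_of_mul_pos_left this (hv i).le
  calc
    _ ≤ ENNReal.ofReal μ :=
        Matrix.spectralRadius_le_of_mulVec_le (fun i j => (hB i j).le) hBv hμle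
    _ < ENNReal.ofReal c := (ENNReal.ofReal_lt_ofReal_iff hc).2 hμ
    _ ≤ _ := Matrix.ofReal_le_spectralRadius hv0 hAv

end Perron

section PowShare

variable {a b : ℝ}

lemma pow_div_add_pow_succ_le (ha : 0 ≤ a) (hb : 0 < b) (hab : a ≤ b) (K : ℕ) :
    a ^ (K + 1) / (a ^ (K + 1) + b ^ (K + 1)) ≤ a ^ K / (a ^ K + b ^ K) := by
  rw [div_le_div_iff₀ (by positivity) (by positivity)]
  have : a ^ K * b ^ K * a ≤ a ^ K * b ^ K * b := mul_le_mul_of_nonneg_left hab (by positivity)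
  linear_combination this

lemma pow_div_add_pow_succ_lt (ha : 0 < a) (hab : a < b) (K : ℕ) :
    a ^ (K + 1) / (a ^ (K + 1) + b ^ (K + 1)) < a ^ K / (a ^ K + b ^ K) := by
  have hb := ha.trans hab
  rw [div_lt_div_iff₀ (by positivity) (by positivity)]
  have : a ^ K * b ^ K * a < a ^ K * b ^ K * b := mul_lt_mul_of_pos_left hab (by positivity)
  linear_combination this

lemma pow_div_add_pow_mono {a' b' : ℝ} (ha : 0 ≤ a) (hb : 0 < b) (hb' : 0 < b') (haa : a ≤ a')
    (hbb : b' ≤ b) (K : ℕ) : a ^ K / (a ^ K + b ^ K) ≤ a' ^ K / (a' ^ K + b' ^ K) := by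
  have ha' := ha.trans haa
  rw [div_le_div_iff₀ (by positivity) (by positivity)]
  have : a ^ K * b' ^ K ≤ a' ^ K * b ^ K := by gcongr
  linear_combination this

lemma pow_div_add_pow_mem_Icc (ha : 0 ≤ a) (hb : 0 < b) (hab : a ≤ b) (K : ℕ) :
    a ^ K / (a ^ K + b ^ K) ∈ Set.Icc (0 : ℝ) (1 / 2) := by
  refine ⟨by positivity, ?_⟩
  rw [div_le_div_iff₀ (by positivity) (by positivity)]
  have : a ^ K ≤ b ^ K := by gcongr
  linarith

end PowShare

/-- Extend a vector on the states `1, …, N - 1` by zero. -/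
def zeroExtend (N : ℕ) (v : Fin (N - 1) → ℝ) (n : ℕ) : ℝ :=
  if h : 0 < n ∧ n < N then v ⟨n - 1, by omega⟩ else 0

lemma continuous_zeroExtend (N n : ℕ) : Continuous fun v => zeroExtend N v n := by
  unfold zeroExtend
  split_ifs <;> fun_prop

lemma zeroExtend_succ (N : ℕ) (v : Fin (N - 1) → ℝ) (i : Fin (N - 1)) :
    zeroExtend N v (i.1 + 1) = v i := by
  have := i.2
  rw [zeroExtend, dif_pos (by omega)]
  rfl

lemma zeroExtend_zero (N : ℕ) (v : Fin (N - 1) → ℝ) : zeroExtend N v 0 = 0 := by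
  simp [zeroExtend]

lemma zeroExtend_self (N : ℕ) (v : Fin (N - 1) → ℝ) : zeroExtend N v N = 0 := by
  simp [zeroExtend]

lemma zeroExtend_smul (N : ℕ) (c : ℝ) (v : Fin (N - 1) → ℝ) (n : ℕ) :
    zeroExtend N (c • v) n = c * zeroExtend N v n := by
  simp only [zeroExtend]
  split_ifs <;> simp

lemma isClosed_symmUnimodal_zeroExtend (N : ℕ) :
    IsClosed {v | SymmUnimodal N (zeroExtend N v)} := by
  have h : {v | SymmUnimodal N (zeroExtend N v)} =
      (⋂ n, {v | 0 ≤ zeroExtend N v n}) ∩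
      ((⋂ n, ⋂ (_ : n ≤ N), {v | zeroExtend N v (N - n) = zeroExtend N v n}) ∩
        ⋂ n, ⋂ (_ : 2 * (n + 1) ≤ N), {v | zeroExtend N v n ≤ zeroExtend N v (n + 1)}) := by
    ext v
    simp only [Set.mem_inter_iff, Set.mem_iInter, Set.mem_ofPred_eq]
    exact ⟨fun h => ⟨h.1, h.2, h.3⟩, fun h => ⟨h.1, h.2.1, h.2.2⟩⟩
  rw [h]
  have hc := continuous_zeroExtend N
  exact (isClosed_iInter fun n => isClosed_le continuous_const (hc n)).inter
    ((isClosed_iInter fun n => isClosed_iInter fun _ => isClosed_eq (hc _) (hc _)).inter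
      (isClosed_iInter fun n => isClosed_iInter fun _ => isClosed_le (hc _) (hc _)))

lemma sum_binomial_mul_eq_binomialMean_eval (N : ℕ) (v : Fin (N - 1) → ℝ) (x : ℝ) :
    ∑ j : Fin (N - 1), (N.choose (j.1 + 1) : ℝ) * x ^ (j.1 + 1) * (1 - x) ^ (N - (j.1 + 1)) * v j
      = (binomialMean N (zeroExtend N v)).eval x := by
  rw [binomialMean_eval, Finset.sum_range_succ, zeroExtend_self, mul_zero, add_zero]
  cases N with
  | zero => simp
  | succ M =>
    rw [Finset.sum_range_succ', zeroExtend_zero, mul_zero, add_zero, Finset.sum_range]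
    exact Finset.sum_congr rfl fun j _ => by rw [zeroExtend_succ (M + 1) v j]

/-- For an integer `N > 2`, a positive integer `K`, and
`q_n(K) = n^K / (n^K + (N-n)^K)` for `n ∈ {1, …, N-1}`, the `(N-1)×(N-1)` matrix
`Q(K)` with entries `Q(K)_{n,m} = C(N,m) q_n(K)^m (1 - q_n(K))^(N-m)` has all
entries strictly positive, and its spectral radius (maximum modulus of complex
eigenvalues) is strictly decreasing in `K`: `ρ(Q(K+1)) < ρ(Q(K))`.
Indices `i j : Fin (N-1)` correspond to states `i+1, j+1 ∈ {1, …, N-1}`. -/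
theorem stmt_2 (N : ℕ) (hN : 2 < N) (K : ℕ) (hK : 1 ≤ K)
    (q : ℕ → ℕ → ℝ)
    (hq : ∀ (K n : ℕ), q K n = (n : ℝ) ^ K / ((n : ℝ) ^ K + ((N : ℝ) - (n : ℝ)) ^ K))
    (Q : ℕ → Matrix (Fin (N - 1)) (Fin (N - 1)) ℝ)
    (hQ : ∀ (K : ℕ) (i j : Fin (N - 1)),
      Q K i j = (N.choose (j.1 + 1) : ℝ) * (q K (i.1 + 1)) ^ (j.1 + 1) *
        (1 - q K (i.1 + 1)) ^ (N - (j.1 + 1))) :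
    (∀ i j, 0 < Q K i j) ∧
    spectralRadius ℂ ((Q (K + 1)).map Complex.ofReal) <
      spectralRadius ℂ ((Q K).map Complex.ofReal) := by
  have hnK : ∀ K n : ℕ, 0 < n → n < N → 0 < q K n ∧ q K n < 1 := fun K n h0 h1 => by
    have h0 : (0 : ℝ) < n := by exact_mod_cast h0
    have h1 : (0 : ℝ) < N - n := sub_pos.2 (by exact_mod_cast h1)
    rw [hq]
    refine ⟨by positivity, (div_lt_one (by positivity)).2 ?_⟩
    have : 0 < ((N : ℝ) - n) ^ K := by positivity
    linarith
  have hQpos : ∀ K i j, 0 < Q K i j := fun K i j => by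
    have hi := i.2
    have hj := j.2
    obtain ⟨h0, h1⟩ := hnK K (i.1 + 1) (by omega) (by omega)
    have hc : 0 < N.choose (j.1 + 1) := Nat.choose_pos (by omega)
    have h1 := sub_pos.2 h1
    rw [hQ]
    positivity
  refine ⟨hQpos K, ?_⟩
  have hQv : ∀ K v i, (Q K).mulVec v i =
      (binomialMean N (zeroExtend N v)).eval (q K (i.1 + 1)) := fun K v i => by
    simp only [← sum_binomial_mul_eq_binomialMean_eval, Matrix.mulVec, dotProduct, hQ]
  have hqsymm : ∀ K n : ℕ, n ≤ N → 1 ≤ K → q K (N - n) = 1 - q K n := fun K n hn hK => by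
    have hn : (n : ℝ) ≤ N := by exact_mod_cast hn
    have hpos : 0 < (n : ℝ) ^ K + ((N : ℝ) - n) ^ K := by
      have h1 : 0 ≤ (n : ℝ) ^ K := by positivity
      have h2 : 0 ≤ ((N : ℝ) - n) ^ K := pow_nonneg (by linarith) _
      rcases n.eq_zero_or_pos with rfl | h
      · have : (0 : ℝ) < N := by exact_mod_cast (by omega : 0 < N)
        simp only [Nat.cast_zero, sub_zero] at h1 ⊢
        positivity
      · positivity
    rw [hq, hq, Nat.cast_sub (by assumption), sub_sub_cancel, add_comm, eq_sub_iff_add_eq,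
      ← add_div, add_comm, div_self hpos.ne']
  have hcast : ∀ n : ℕ, 2 * n ≤ N → (0 : ℝ) < N - n ∧ (n : ℝ) ≤ N - n := fun n hn => by
    have h1 : (2 : ℝ) * n ≤ N := by exact_mod_cast hn
    have h2 : (2 : ℝ) < N := by exact_mod_cast hN
    constructor <;> linarith
  have hqIcc : ∀ K n : ℕ, 2 * n ≤ N → q K n ∈ Set.Icc (0 : ℝ) (1 / 2) := fun K n hn => by
    rw [hq]
    exact pow_div_add_pow_mem_Icc (by positivity) (hcast n hn).1 (hcast n hn).2 K
  have hmono : ∀ v, SymmUnimodal N (zeroExtend N v) →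
      MonotoneOn (fun x => (binomialMean N (zeroExtend N v)).eval x) (Set.Icc 0 (1 / 2)) := by
    obtain ⟨M, rfl⟩ : ∃ M, N = M + 1 := ⟨N - 1, by omega⟩
    exact fun v hv => hv.monotoneOn (hv.mono 0 (by omega))
  have hpres : ∀ v, SymmUnimodal N (zeroExtend N v) →
      SymmUnimodal N (zeroExtend N ((Q K).mulVec v)) := fun v hv => by
    have hext : ∀ n ≤ N, zeroExtend N ((Q K).mulVec v) n =
        (binomialMean N (zeroExtend N v)).eval (q K n) := fun n hn => by
      have hz : (binomialMean N (zeroExtend N v)).eval (q K 0) = 0 := by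
        rw [hq, Nat.cast_zero, zero_pow (by omega), zero_div, binomialMean_eval]
        refine Finset.sum_eq_zero fun m _ => ?_
        rcases m.eq_zero_or_pos with rfl | hm
        · rw [zeroExtend_zero, mul_zero]
        · rw [zero_pow (by omega)]; ring
      by_cases h : 0 < n ∧ n < N
      · rw [zeroExtend, dif_pos h, hQv]
        simp only [Nat.sub_add_cancel h.1]
      · rw [zeroExtend, dif_neg h]
        rcases (by omega : n = 0 ∨ n = N) with rfl | rfl
        · exact hz.symm
        · rw [← hz, ← binomialMean_eval_one_sub _ _ hv.symm, ← hqsymm K 0 (by omega) hK,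
            Nat.sub_zero]
    have hmonoK : ∀ n, 2 * (n + 1) ≤ N → q K n ≤ q K (n + 1) := fun n hn => by
      rw [hq, hq]
      exact pow_div_add_pow_mono (by positivity) (hcast n (by omega)).1 (hcast _ hn).1
        (by push_cast; linarith) (by push_cast; linarith) K
    refine ⟨fun n => ?_, fun n hn => ?_, fun n hn => ?_⟩
    · rw [zeroExtend]
      split_ifs with h
      · simp only [Matrix.mulVec, dotProduct]
        exact Finset.sum_nonneg fun j _ => mul_nonneg (hQpos K _ j).le
          (by rw [← zeroExtend_succ N v j]; exact hv.nonneg _)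
      · exact le_rfl
    · rw [hext _ (N.sub_le n), hext n hn, hqsymm K n hn hK,
        binomialMean_eval_one_sub _ _ hv.symm]
    · rw [hext n (by omega), hext _ (by omega)]
      exact hmono v hv (hqIcc K n (by omega)) (hqIcc K _ hn) (hmonoK n hn)
  have : Nonempty (Fin (N - 1)) := ⟨⟨0, by omega⟩⟩
  have hone : SymmUnimodal N (zeroExtend N 1) := by
    have h1 : ∀ n, zeroExtend N 1 n = if 0 < n ∧ n < N then 1 else 0 := fun n => by
      simp [zeroExtend]
    refine ⟨fun n => ?_, fun n hn => ?_, fun n hn => ?_⟩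
    · rw [h1]; split_ifs <;> norm_num
    · rw [h1, h1]; exact if_congr (by omega) rfl rfl
    · rw [h1, h1, if_pos (by omega : 0 < n + 1 ∧ n + 1 < N)]
      split_ifs <;> norm_num
  obtain ⟨v, hvS, c, hv, hQc⟩ := Matrix.exists_pos_eigenvector_mem (hQpos K)
    (isClosed_symmUnimodal_zeroExtend N)
    (fun v hv i => by rw [← zeroExtend_succ N v i]; exact hv.nonneg _)
    (fun v hv c hc => by
      refine ⟨fun n => ?_, fun n hn => ?_, fun n hn => ?_⟩ <;> simp only [zeroExtend_smul]
      · exact mul_nonneg hc.le (hv.nonneg n)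
      · rw [hv.symm n hn]
      · exact mul_le_mul_of_nonneg_left (hv.mono n hn) hc.le)
    hpres hone one_ne_zero
  refine Matrix.spectralRadius_lt_of_mulVec_le (hQpos (K + 1)) hv hQc (fun i => ?_) ?_
  · have hle : ∀ n : ℕ, 2 * n ≤ N →
        (binomialMean N (zeroExtend N v)).eval (q (K + 1) n) ≤
          (binomialMean N (zeroExtend N v)).eval (q K n) := fun n hn =>
      hmono v hvS (hqIcc _ n hn) (hqIcc _ n hn) (by
        rw [hq, hq]
        exact pow_div_add_pow_succ_le (by positivity) (hcast n hn).1 (hcast n hn).2 K)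
    have hi := i.2
    rw [hQv, hQv]
    rcases le_total (2 * (i.1 + 1)) N with h | h
    · exact hle _ h
    · rw [← binomialMean_eval_one_sub _ _ hvS.symm,
        ← binomialMean_eval_one_sub _ _ hvS.symm (q K _), ← hqsymm K _ (by omega) hK,
        ← hqsymm (K + 1) _ (by omega) (by omega)]
      exact hle _ (by omega)
  · refine ⟨⟨0, by omega⟩, ?_⟩
    rw [hQv, hQv]
    have hstrict : StrictMonoOn (fun x => (binomialMean N (zeroExtend N v)).eval x)
        (Set.Icc 0 (1 / 2)) := by
      obtain ⟨M, rfl⟩ : ∃ M, N = M + 1 := ⟨N - 1, by omega⟩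
      refine hvS.strictMonoOn (by omega) ?_
      have := hv ⟨0, by omega⟩
      rwa [zeroExtend_zero, zeroExtend, dif_pos (by omega)]
    have h1 : 2 * (0 + 1) ≤ N := by omega
    refine hstrict (hqIcc _ _ h1) (hqIcc _ _ h1) ?_
    rw [hq, hq]
    have h2 : (2 : ℝ) < N := by exact_mod_cast hN
    exact pow_div_add_pow_succ_lt (by norm_num) (by norm_num; linarith) K
end

section
/- Let A be an N×N real matrix with nonnegative entries whose columns each sum to 1 (a left-stochastic matrix). For k = 1, …, N let R_k be an M×M real symmetric positive-definite matrix and let μ_k be a real number with 0 < μ_k < 2/λ_max(R_k), where λ_max(R_k) is the largest eigenvalue of R_k. Let M_blk = diag(μ_1 I_M, …, μ_N I_M), R_blk = diag(R_1, …, R_N), and B = (Aᵀ ⊗ I_M)(I_{NM} − M_blk R_blk). Then the spectral radius of B is strictly less than 1. This conclusion holds for every left-stochastic A. -/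
open Matrix Kronecker

/-- A real symmetric matrix with spectrum in `(-1, 1)` strictly shrinks nonzero vectors. -/
theorem sum_sq_mulVec_lt {n : Type*} [Fintype n] [DecidableEq n] {S : Matrix n n ℝ}
    (hS : S.IsHermitian) (hspec : ∀ x ∈ spectrum ℝ S, |x| < 1) {u : n → ℝ} (hu : u ≠ 0) :
    ∑ i, (S *ᵥ u) i ^ 2 < ∑ i, u i ^ 2 := by
  set b := hS.eigenvectorBasis
  have hnorm (w : n → ℝ) : ∑ i, w i ^ 2 = ∑ i, (inner ℝ (b i) (WithLp.toLp 2 w)) ^ 2 := by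
    have := b.sum_sq_norm_inner_right (WithLp.toLp 2 w)
    rw [EuclideanSpace.norm_sq_eq] at this
    simpa using this.symm
  have hinner (i : n) : inner ℝ (b i) (WithLp.toLp 2 (S *ᵥ u))
      = hS.eigenvalues i * inner ℝ (b i) (WithLp.toLp 2 u) := by
    have h := hS.mulVec_eigenvectorBasis i
    have ht : Sᵀ = S := by simpa [Matrix.IsHermitian, conjTranspose_eq_transpose_of_trivial] using hS
    rw [EuclideanSpace.inner_eq_star_dotProduct, EuclideanSpace.inner_eq_star_dotProduct]
    simp only [star_trivial]
    rw [dotProduct_comm, dotProduct_mulVec, ← mulVec_transpose, ht, h, smul_dotProduct,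
      smul_eq_mul, dotProduct_comm]
  have hlt (i : n) : hS.eigenvalues i ^ 2 < 1 :=
    (sq_lt_one_iff_abs_lt_one _).2 (hspec _ (hS.eigenvalues_mem_spectrum_real i))
  rw [hnorm u, hnorm (S *ᵥ u)]
  have hpos : 0 < ∑ i, u i ^ 2 := by
    obtain ⟨i, hi⟩ := Function.ne_iff.1 hu
    exact Finset.sum_pos' (fun i _ => sq_nonneg _) ⟨i, Finset.mem_univ i, by
      have : u i ≠ 0 := hi
      positivity⟩
  rw [hnorm u] at hpos
  obtain ⟨i, -, hi⟩ := Finset.exists_lt_of_sum_lt (s := Finset.univ)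
    (f := fun _ : n => (0 : ℝ)) (by simpa using hpos)
  refine Finset.sum_lt_sum (fun j _ => ?_) ⟨i, Finset.mem_univ i, ?_⟩
  · rw [hinner, mul_pow]
    exact mul_le_of_le_one_left (sq_nonneg _) (hlt j).le
  · rw [hinner, mul_pow]
    exact mul_lt_of_lt_one_left hi (hlt i)

/-- The complexification of a real symmetric matrix with spectrum in `(-1, 1)` strictly shrinks
the Euclidean norm of nonzero complex vectors. -/
theorem norm_map_ofReal_mulVec_lt {n : Type*} [Fintype n] [DecidableEq n] {S : Matrix n n ℝ}
    (hS : S.IsHermitian) (hspec : ∀ x ∈ spectrum ℝ S, |x| < 1) {v : n → ℂ} (hv : v ≠ 0) :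
    ‖WithLp.toLp 2 (S.map Complex.ofReal *ᵥ v)‖ < ‖WithLp.toLp 2 v‖ := by
  have hle (u : n → ℝ) : ∑ i, (S *ᵥ u) i ^ 2 ≤ ∑ i, u i ^ 2 := by
    rcases eq_or_ne u 0 with rfl | hu
    · simp
    · exact (sum_sq_mulVec_lt hS hspec hu).le
  have hsplit (w : n → ℂ) : ‖WithLp.toLp 2 w‖ ^ 2 = ∑ i, (w i).re ^ 2 + ∑ i, (w i).im ^ 2 := by
    rw [EuclideanSpace.norm_sq_eq, ← Finset.sum_add_distrib]
    refine Finset.sum_congr rfl fun i _ => ?_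
    rw [← Complex.normSq_eq_norm_sq, Complex.normSq_apply]
    ring
  have hre (i : n) : ((S.map Complex.ofReal *ᵥ v) i).re = (S *ᵥ fun j => (v j).re) i := by
    simp [mulVec, dotProduct]
  have him (i : n) : ((S.map Complex.ofReal *ᵥ v) i).im = (S *ᵥ fun j => (v j).im) i := by
    simp [mulVec, dotProduct]
  refine lt_of_pow_lt_pow_left₀ 2 (norm_nonneg _) ?_
  rw [hsplit, hsplit]
  simp only [hre, him]
  by_cases h : (fun j => (v j).re) = 0
  · refine add_lt_add_of_le_of_lt (hle _) (sum_sq_mulVec_lt hS hspec fun h' => hv ?_)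
    ext j
    exact Complex.ext (congrFun h j) (congrFun h' j)
  · exact add_lt_add_of_lt_of_le (sum_sq_mulVec_lt hS hspec h) (hle _)

/-- If `0 < μ < 2 / λ_max(R)` with `R` positive definite, then `1 - μ R` has spectrum
in `(-1, 1)`. -/
theorem abs_lt_one_of_mem_spectrum_one_sub_smul {n : Type*} [Fintype n] [DecidableEq n]
    {R : Matrix n n ℝ} (hR : R.PosDef) {l μ : ℝ} (hl : IsGreatest (spectrum ℝ R) l)
    (hμ : 0 < μ) (hμl : μ < 2 / l) {x : ℝ} (hx : x ∈ spectrum ℝ (1 - μ • R)) : |x| < 1 := by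
  have hpos : ∀ y ∈ spectrum ℝ R, 0 < y := by
    intro y hy
    rw [hR.1.spectrum_real_eq_range_eigenvalues] at hy
    obtain ⟨i, rfl⟩ := hy
    exact hR.eigenvalues_pos i
  rw [← map_one (algebraMap ℝ (Matrix n n ℝ)), ← spectrum.singleton_sub_eq] at hx
  obtain ⟨_, rfl, z, hz, rfl⟩ := Set.mem_sub.1 hx
  have hu := spectrum.unit_smul_eq_smul R (Units.mk0 μ hμ.ne')
  rw [show Units.mk0 μ hμ.ne' • R = μ • R from rfl] at hu
  rw [hu] at hz
  obtain ⟨y, hy, rfl⟩ := Set.mem_smul_set.1 hz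
  have hy0 := hpos y hy
  have hyl : μ * y < 2 :=
    (mul_le_mul_of_nonneg_left (hl.2 hy) hμ.le).trans_lt ((lt_div_iff₀ (hpos l hl.1)).1 hμl)
  have hxy : Units.mk0 μ hμ.ne' • y = μ * y := rfl
  rw [hxy, abs_lt]
  constructor <;> nlinarith [mul_pos hμ hy0]

/-- The spectral radius of a complex matrix is less than one as soon as all of its eigenvalues
are. -/
theorem spectralRadius_lt_one_of_forall_mulVec {n : Type*} [Fintype n] [DecidableEq n]
    {B : Matrix n n ℂ}
    (h : ∀ (z : ℂ) (v : n → ℂ), v ≠ 0 → B *ᵥ v = z • v → ‖z‖ < 1) :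
    spectralRadius ℂ B < 1 := by
  have hfin : (spectrum ℂ B).Finite := Matrix.finite_spectrum B
  have hlt : ∀ z ∈ spectrum ℂ B, (‖z‖₊ : ENNReal) < 1 := by
    intro z hz
    rw [← Matrix.spectrum_toLin', ← Module.End.hasEigenvalue_iff_mem_spectrum] at hz
    obtain ⟨v, hv⟩ := hz.exists_hasEigenvector
    have := h z v hv.2 (by simpa using hv.apply_eq_smul)
    exact_mod_cast this
  have heq : spectralRadius ℂ B = hfin.toFinset.sup fun z => (‖z‖₊ : ENNReal) := by
    simp [spectralRadius, Finset.sup_eq_iSup]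
  rw [heq, Finset.sup_lt_iff (by simp)]
  simpa using hlt

/-- Let `A` be an `N×N` left-stochastic matrix (nonnegative entries,
columns summing to 1), let `R_k` be `M×M` symmetric positive-definite matrices with
largest eigenvalues `λ_max(R_k)`, and let step-sizes satisfy `0 < μ_k < 2/λ_max(R_k)`.
With `M_blk = diag(μ_1 I_M, …, μ_N I_M)`, `R_blk = diag(R_1, …, R_N)` and
`B = (Aᵀ ⊗ I_M)(I_{NM} - M_blk R_blk)`, the spectral radius of `B` is strictly
less than 1 (for every such left-stochastic `A`). -/
theorem stmt_5 (N M : ℕ) (A : Matrix (Fin N) (Fin N) ℝ)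
    (hA_nonneg : ∀ i j, 0 ≤ A i j)
    (hA_col : ∀ j, ∑ i, A i j = 1)
    (R : Fin N → Matrix (Fin M) (Fin M) ℝ)
    (hR : ∀ k, (R k).PosDef)
    (lamMax : Fin N → ℝ)
    (hlam : ∀ k, IsGreatest (spectrum ℝ (R k)) (lamMax k))
    (μ : Fin N → ℝ)
    (hμ : ∀ k, 0 < μ k ∧ μ k < 2 / lamMax k)
    (Mblk Rblk : Matrix (Fin N × Fin M) (Fin N × Fin M) ℝ)
    (hMblk : Mblk = (Matrix.diagonal μ) ⊗ₖ (1 : Matrix (Fin M) (Fin M) ℝ))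
    (hRblk : ∀ (k l : Fin N) (i j : Fin M),
      Rblk (k, i) (l, j) = if k = l then R k i j else 0)
    (B : Matrix (Fin N × Fin M) (Fin N × Fin M) ℝ)
    (hB : B = (Aᵀ ⊗ₖ (1 : Matrix (Fin M) (Fin M) ℝ)) * (1 - Mblk * Rblk)) :
    spectralRadius ℂ (B.map Complex.ofReal) < 1 := by
  have hS (k : Fin N) : (1 - μ k • R k).IsHermitian := by
    have hR' := (hR k).1
    simp only [Matrix.IsHermitian, conjTranspose_eq_transpose_of_trivial] at hR' ⊢
    simp [hR']
  have hspec (k : Fin N) : ∀ x ∈ spectrum ℝ (1 - μ k • R k), |x| < 1 := fun _ =>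
    abs_lt_one_of_mem_spectrum_one_sub_smul (hR k) (hlam k) (hμ k).1 (hμ k).2
  have hBentry (k l : Fin N) (i j : Fin M) :
      B (k, i) (l, j) = A l k * (1 - μ l • R l) i j := by
    have hMR (p q : Fin N × Fin M) : (Mblk * Rblk) p q = μ p.1 * Rblk p q := by
      rw [hMblk, ← diagonal_one, diagonal_kronecker_diagonal, diagonal_mul]
      simp
    rw [hB, mul_apply, Fintype.sum_prod_type]
    simp only [kroneckerMap_apply, transpose_apply, Matrix.sub_apply, hMR, hRblk, one_apply,
      Prod.mk.injEq, Matrix.smul_apply, smul_eq_mul]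
    rw [Finset.sum_eq_single l (by intro b _ hb; simp [hb]) (by simp)]
    simp
  refine spectralRadius_lt_one_of_forall_mulVec fun z v hv hz => ?_
  let blk (k : Fin N) : Fin M → ℂ := fun i => v (k, i)
  let w (k : Fin N) : Fin M → ℂ := (1 - μ k • R k).map Complex.ofReal *ᵥ blk k
  have hblk (k : Fin N) : z • WithLp.toLp 2 (blk k)
      = ∑ l, (A l k : ℂ) • WithLp.toLp 2 (w l) := by
    ext i
    have hki := congrFun hz (k, i)
    simp only [mulVec, dotProduct, Fintype.sum_prod_type, map_apply, hBentry] at hki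
    simp only [PiLp.smul_apply, WithLp.ofLp_sum, WithLp.ofLp_smul, Finset.sum_apply, Pi.smul_apply,
      w, mulVec, dotProduct, map_apply, smul_eq_mul, Finset.mul_sum]
    refine hki.symm.trans ?_
    refine Finset.sum_congr rfl fun l _ => Finset.sum_congr rfl fun j _ => ?_
    simp only [blk]
    push_cast
    ring
  obtain ⟨⟨k₀, i₀⟩, hne⟩ := Function.ne_iff.1 hv
  obtain ⟨k, -, hmax⟩ := Finset.exists_max_image Finset.univ
    (fun k => ‖WithLp.toLp 2 (blk k)‖) ⟨k₀, Finset.mem_univ k₀⟩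
  have hkpos : 0 < ‖WithLp.toLp 2 (blk k)‖ := by
    refine lt_of_lt_of_le (norm_pos_iff.2 fun h => hne ?_) (hmax k₀ (Finset.mem_univ k₀))
    exact congrArg (fun x : EuclideanSpace ℂ (Fin M) => x i₀) h
  have hw (l : Fin N) : ‖WithLp.toLp 2 (w l)‖ < ‖WithLp.toLp 2 (blk k)‖ := by
    by_cases h : blk l = 0
    · simpa [w, h] using hkpos
    · exact (norm_map_ofReal_mulVec_lt (hS l) (hspec l) h).trans_le (hmax l (Finset.mem_univ l))
  obtain ⟨l₀, -, hl₀⟩ := Finset.exists_lt_of_sum_lt (s := Finset.univ)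
    (f := fun _ => (0 : ℝ)) (g := fun l => A l k) (by simp [hA_col k])
  have hlt : ‖z‖ * ‖WithLp.toLp 2 (blk k)‖ < 1 * ‖WithLp.toLp 2 (blk k)‖ := calc
    _ = ‖∑ l, (A l k : ℂ) • WithLp.toLp 2 (w l)‖ := by rw [← hblk k, norm_smul]
    _ ≤ ∑ l, A l k * ‖WithLp.toLp 2 (w l)‖ := by
      refine (norm_sum_le _ _).trans_eq (Finset.sum_congr rfl fun l _ => ?_)
      rw [norm_smul, Complex.norm_real, Real.norm_of_nonneg (hA_nonneg l k)]
    _ < ∑ l, A l k * ‖WithLp.toLp 2 (blk k)‖ :=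
      Finset.sum_lt_sum (fun l _ => mul_le_mul_of_nonneg_left (hw l).le (hA_nonneg l k))
        ⟨l₀, Finset.mem_univ l₀, mul_lt_mul_of_pos_left (hw l₀) hl₀⟩
    _ = 1 * ‖WithLp.toLp 2 (blk k)‖ := by rw [← Finset.sum_mul, hA_col k]
  exact lt_of_mul_lt_mul_right hlt hkpos.le
end

section
/- Let A be an N×N left-stochastic primitive matrix (nonnegative entries, columns summing to 1, and there exists an integer j > 0 such that all entries of A^j are strictly positive). Let S ⊆ {1, …, N} be a nonempty subset (the informed nodes). For k = 1, …, N let R_k be an M×M symmetric positive-definite matrix, and choose step-sizes μ_k with 0 < μ_k < 2/λ_max(R_k) for k ∈ S and μ_k = 0 for k ∉ S. Let M_e = diag(μ_1 I_M, …, μ_N I_M), R_blk = diag(R_1, …, R_N), and B = (Aᵀ ⊗ I_M)(I_{NM} − M_e R_blk). Then the spectral radius of B is strictly less than 1; consequently the recursion x_i = B x_{i−1} converges to zero for every initial condition. -/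
open Matrix Kronecker

/-- In a complex Banach algebra, the powers of an element of spectral radius less than one
tend to zero. -/
theorem tendsto_pow_zero_of_spectralRadius_lt_one {E : Type*} [NormedRing E] [NormedAlgebra ℂ E]
    [CompleteSpace E] {a : E} (ha : spectralRadius ℂ a < 1) :
    Filter.Tendsto (fun n : ℕ => a ^ n) Filter.atTop (nhds 0) := by
  obtain ⟨r, har, hr1⟩ := ENNReal.lt_iff_exists_nnreal_btwn.1 ha
  have hr1' : r < 1 := by exact_mod_cast hr1
  have hgelfand := spectrum.pow_nnnorm_pow_one_div_tendsto_nhds_spectralRadius a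
  refine squeeze_zero_norm' (a := fun n : ℕ => (r : ℝ) ^ n) ?_
    (tendsto_pow_atTop_nhds_zero_of_lt_one r.2 (by exact_mod_cast hr1'))
  filter_upwards [hgelfand.eventually_lt_const har, Filter.eventually_gt_atTop 0] with n hn hn0
  have hn' : (0 : ℝ) < n := by exact_mod_cast hn0
  have h := ENNReal.rpow_le_rpow hn.le hn'.le
  rw [← ENNReal.rpow_mul, one_div_mul_cancel hn'.ne', ENNReal.rpow_one, ENNReal.rpow_natCast] at h
  have h' : ‖a ^ n‖₊ ≤ r ^ n := by exact_mod_cast h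
  exact_mod_cast h'

/-- If every factor `1 - t * λᵢ` has modulus less than one, then `1 - t • R` strictly decreases
the sum of squares of every nonzero real vector. -/
theorem Matrix.IsHermitian.sum_sq_one_sub_smul_mulVec_lt {m : Type*} [Fintype m] [DecidableEq m]
    {R : Matrix m m ℝ} (hR : R.IsHermitian) {t : ℝ} (ht : ∀ i, |1 - t * hR.eigenvalues i| < 1)
    {a : m → ℝ} (ha : a ≠ 0) :
    ∑ i, ((1 - t • R) *ᵥ a) i ^ 2 < ∑ i, a i ^ 2 := by
  have hnorm (x : m → ℝ) : ∑ i, x i ^ 2 =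
      ∑ i, (inner ℝ (hR.eigenvectorBasis i) (WithLp.toLp 2 x)) ^ 2 := by
    have h := hR.eigenvectorBasis.sum_sq_norm_inner_right (WithLp.toLp 2 x)
    rw [EuclideanSpace.norm_sq_eq] at h
    simpa using h.symm
  have hinner (i : m) : inner ℝ (hR.eigenvectorBasis i) (WithLp.toLp 2 ((1 - t • R) *ᵥ a)) =
      (1 - t * hR.eigenvalues i) * inner ℝ (hR.eigenvectorBasis i) (WithLp.toLp 2 a) := by
    have hT : (1 - t • R)ᵀ = 1 - t • R := by
      have h := hR.eq
      rw [conjTranspose_eq_transpose_of_trivial] at h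
      simp [h]
    simp only [EuclideanSpace.inner_eq_star_dotProduct, star_trivial]
    rw [dotProduct_comm, dotProduct_mulVec, ← mulVec_transpose, hT, sub_mulVec, one_mulVec,
      smul_mulVec, hR.mulVec_eigenvectorBasis, sub_dotProduct, smul_dotProduct, smul_dotProduct,
      dotProduct_comm]
    simp only [smul_eq_mul]
    ring
  have hpos : 0 < ∑ i, a i ^ 2 := by
    obtain ⟨i, hi⟩ := Function.ne_iff.1 ha
    exact Finset.sum_pos' (fun _ _ => sq_nonneg _) ⟨i, Finset.mem_univ _, sq_pos_of_ne_zero hi⟩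
  rw [hnorm] at hpos
  rw [hnorm, hnorm a]
  have hfac (i : m) : (1 - t * hR.eigenvalues i) ^ 2 < 1 := (sq_lt_one_iff_abs_lt_one _).2 (ht i)
  obtain ⟨i, -, hi⟩ := Finset.exists_ne_zero_of_sum_ne_zero hpos.ne'
  refine Finset.sum_lt_sum (fun i _ => ?_) ⟨i, Finset.mem_univ _, ?_⟩
  · rw [hinner, mul_pow]
    exact mul_le_of_le_one_left (sq_nonneg _) (hfac i).le
  · rw [hinner, mul_pow]
    exact mul_lt_of_lt_one_left (lt_of_le_of_ne (sq_nonneg _) hi.symm) (hfac i)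

/-- A real matrix strictly decreasing the sum of squares of nonzero real vectors strictly
decreases the Euclidean norm of nonzero complex vectors. -/
theorem Matrix.norm_toLp_map_ofReal_mulVec_lt {m : Type*} [Fintype m]
    {C : Matrix m m ℝ} (hC : ∀ a ≠ 0, ∑ i, (C *ᵥ a) i ^ 2 < ∑ i, a i ^ 2)
    {v : m → ℂ} (hv : v ≠ 0) :
    ‖WithLp.toLp 2 (C.map Complex.ofReal *ᵥ v)‖ < ‖WithLp.toLp 2 v‖ := by
  have hsq (w : m → ℂ) : ‖WithLp.toLp 2 w‖ ^ 2 = ∑ i, (w i).re ^ 2 + ∑ i, (w i).im ^ 2 := by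
    simp only [EuclideanSpace.norm_sq_eq, ← Finset.sum_add_distrib]
    refine Finset.sum_congr rfl fun i _ => ?_
    rw [Complex.sq_norm, Complex.normSq_apply]
    ring
  have hre (i : m) : ((C.map Complex.ofReal *ᵥ v) i).re = (C *ᵥ fun j => (v j).re) i := by
    simp [mulVec, dotProduct]
  have him (i : m) : ((C.map Complex.ofReal *ᵥ v) i).im = (C *ᵥ fun j => (v j).im) i := by
    simp [mulVec, dotProduct]
  have hle (a : m → ℝ) : ∑ i, (C *ᵥ a) i ^ 2 ≤ ∑ i, a i ^ 2 := by
    rcases eq_or_ne a 0 with rfl | ha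
    · simp
    · exact (hC a ha).le
  refine lt_of_pow_lt_pow_left₀ 2 (norm_nonneg _) ?_
  simp only [hsq, hre, him]
  by_cases h : (fun j => (v j).re) = 0
  · have h' : (fun j => (v j).im) ≠ 0 := fun h' =>
      hv (funext fun j => Complex.ext (congrFun h j) (congrFun h' j))
    exact add_lt_add_of_le_of_lt (hle _) (hC _ h')
  · exact add_lt_add_of_lt_of_le (hC _ h) (hle _)

/-- Let `A` be a left-stochastic matrix with a positive power. If `d ≤ x` and `x ≤ d ᵥ* A`
entrywise, with `d s < x s` unless `x s = 0` at some index `s`, then `x = 0`. -/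
theorem Matrix.eq_zero_of_le_vecMul_of_primitive {n : Type*} [Fintype n] [DecidableEq n]
    {A : Matrix n n ℝ} (hA : ∀ i j, 0 ≤ A i j) (hcol : ∀ j, ∑ i, A i j = 1)
    (hprim : ∃ p : ℕ, 0 < p ∧ ∀ k l, 0 < (A ^ p) k l)
    {x d : n → ℝ} (hdx : ∀ k, d k ≤ x k) (hxd : ∀ k, x k ≤ (d ᵥ* A) k)
    {s : n} (hs : x s ≠ 0 → d s < x s) : x = 0 := by
  obtain ⟨p, hp, hpos⟩ := hprim
  have hmono {y z : n → ℝ} (h : ∀ k, y k ≤ z k) (k : n) : (y ᵥ* A) k ≤ (z ᵥ* A) k :=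
    Finset.sum_le_sum fun i _ => mul_le_mul_of_nonneg_right (h i) (hA i k)
  have hpow (q : ℕ) : ∀ k, x k ≤ (x ᵥ* A ^ q) k := by
    induction q with
    | zero => simp
    | succ q ih =>
      intro k
      rw [pow_succ, ← vecMul_vecMul]
      exact ((hxd k).trans (hmono hdx k)).trans (hmono ih k)
  have hcolpow (q : ℕ) : (1 : n → ℝ) ᵥ* A ^ q = 1 := by
    induction q with
    | zero => simp
    | succ q ih =>
      rw [pow_succ, ← vecMul_vecMul, ih]
      ext j
      simpa [vecMul, dotProduct] using hcol j
  obtain ⟨k, -, hk⟩ := Finset.exists_max_image Finset.univ x ⟨s, Finset.mem_univ s⟩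
  have hconst (l : n) : x l = x k := by
    by_contra hne
    have hlt : (x ᵥ* A ^ p) k < ((x k • (1 : n → ℝ)) ᵥ* A ^ p) k := by
      refine Finset.sum_lt_sum (fun i _ => ?_) ⟨l, Finset.mem_univ l, ?_⟩
      · simpa using mul_le_mul_of_nonneg_right (hk i (Finset.mem_univ i)) (hpos i k).le
      · simpa using mul_lt_mul_of_pos_right
          (lt_of_le_of_ne (hk l (Finset.mem_univ l)) hne) (hpos l k)
    rw [smul_vecMul, hcolpow] at hlt
    simp only [Pi.smul_apply, Pi.one_apply, smul_eq_mul, mul_one] at hlt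
    exact (hpow p k).not_gt hlt
  by_contra hx0
  have hxk : x k ≠ 0 := fun h => hx0 (funext fun l => (hconst l).trans h)
  have hds : d s < x s := hs (by rwa [hconst s])
  obtain ⟨q, rfl⟩ := Nat.exists_eq_succ_of_ne_zero hp.ne'
  obtain ⟨j, hj⟩ : ∃ j, 0 < A s j := by
    by_contra! h
    have hrow : ∀ j, A s j = 0 := fun j => le_antisymm (h j) (hA s j)
    have := hpos s s
    simp [pow_succ', mul_apply, hrow] at this
  have hlt : (d ᵥ* A) j < (x ᵥ* A) j :=
    Finset.sum_lt_sum (fun i _ => mul_le_mul_of_nonneg_right (hdx i) (hA i j))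
      ⟨s, Finset.mem_univ s, mul_lt_mul_of_pos_right hds hj⟩
  have hxA : (x ᵥ* A) j = x j := by
    have : x = x k • (1 : n → ℝ) := funext fun l => by simp [hconst l]
    have h1 := hcolpow 1
    rw [pow_one] at h1
    rw [this, smul_vecMul, h1]
  exact (hxd j).not_gt (hlt.trans_eq hxA)

/-- The block rows of `(Aᵀ ⊗ I) (I - (diag μ ⊗ I) Rblk)` applied to a vector. -/
theorem Matrix.diffusion_mulVec {n m : Type*} [Fintype n] [DecidableEq n] [Fintype m]
    [DecidableEq m] (A : Matrix n n ℝ) (R : n → Matrix m m ℝ) (μ : n → ℝ)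
    {Rblk : Matrix (n × m) (n × m) ℝ}
    (hRblk : ∀ k l i j, Rblk (k, i) (l, j) = if k = l then R k i j else 0)
    (v : n × m → ℂ) (k : n) :
    (fun i => (((Aᵀ ⊗ₖ (1 : Matrix m m ℝ)) *
        (1 - (diagonal μ ⊗ₖ (1 : Matrix m m ℝ)) * Rblk)).map Complex.ofReal *ᵥ v) (k, i)) =
      ∑ l, (A l k : ℂ) • ((1 - μ l • R l).map Complex.ofReal *ᵥ fun j => v (l, j)) := by
  have hinner (l : n) (i : m) :
      ((1 - (diagonal μ ⊗ₖ (1 : Matrix m m ℝ)) * Rblk).map Complex.ofReal *ᵥ v) (l, i) =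
        ((1 - μ l • R l).map Complex.ofReal *ᵥ fun j => v (l, j)) i := by
    simp only [mulVec, dotProduct, Fintype.sum_prod_type]
    rw [Finset.sum_eq_single l]
    · refine Finset.sum_congr rfl fun j _ => ?_
      simp [mul_apply, Fintype.sum_prod_type, kroneckerMap_apply, diagonal_apply, hRblk, one_apply]
    · intro l' _ hl'
      refine Finset.sum_eq_zero fun j _ => ?_
      simp [mul_apply, Fintype.sum_prod_type, kroneckerMap_apply, diagonal_apply, hRblk, one_apply,
        hl'.symm]
    · simp
  have hmap (X Y : Matrix (n × m) (n × m) ℝ) : (X * Y).map Complex.ofReal =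
      X.map Complex.ofReal * Y.map Complex.ofReal := Matrix.map_mul (f := Complex.ofRealHom)
  ext i
  rw [hmap, ← mulVec_mulVec]
  generalize hw : (1 - (diagonal μ ⊗ₖ (1 : Matrix m m ℝ)) * Rblk).map Complex.ofReal *ᵥ v = w
    at hinner
  simp only [Finset.sum_apply, Pi.smul_apply, ← hinner, smul_eq_mul]
  simp [mulVec, dotProduct, Fintype.sum_prod_type, kroneckerMap_apply, one_apply,
    apply_ite Complex.ofReal, ite_mul]

/-- Let `A` be an `N×N` left-stochastic primitive matrix, `S` a nonempty
set of informed nodes, `R_k` symmetric positive-definite with largest eigenvalue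
`λ_max(R_k)`, and step-sizes `0 < μ_k < 2/λ_max(R_k)` for `k ∈ S`, `μ_k = 0` for
`k ∉ S`. With `M_e = diag(μ_1 I_M, …, μ_N I_M)`, `R_blk = diag(R_1, …, R_N)` and
`B = (Aᵀ ⊗ I_M)(I_{NM} - M_e R_blk)`, the spectral radius of `B` is strictly less
than 1, and the recursion `x_i = B x_{i-1}` converges to zero for every initial
condition. -/
theorem stmt_6 (N M : ℕ) (A : Matrix (Fin N) (Fin N) ℝ)
    (hA_nonneg : ∀ i j, 0 ≤ A i j)
    (hA_col : ∀ j, ∑ i, A i j = 1)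
    (hA_prim : ∃ j : ℕ, 0 < j ∧ ∀ k l, 0 < (A ^ j) k l)
    (S : Finset (Fin N)) (hS : S.Nonempty)
    (R : Fin N → Matrix (Fin M) (Fin M) ℝ)
    (hR : ∀ k, (R k).PosDef)
    (lamMax : Fin N → ℝ)
    (hlam : ∀ k, IsGreatest (spectrum ℝ (R k)) (lamMax k))
    (μ : Fin N → ℝ)
    (hμS : ∀ k ∈ S, 0 < μ k ∧ μ k < 2 / lamMax k)
    (hμSc : ∀ k ∉ S, μ k = 0)
    (Me Rblk : Matrix (Fin N × Fin M) (Fin N × Fin M) ℝ)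
    (hMe : Me = (Matrix.diagonal μ) ⊗ₖ (1 : Matrix (Fin M) (Fin M) ℝ))
    (hRblk : ∀ (k l : Fin N) (i j : Fin M),
      Rblk (k, i) (l, j) = if k = l then R k i j else 0)
    (B : Matrix (Fin N × Fin M) (Fin N × Fin M) ℝ)
    (hB : B = (Aᵀ ⊗ₖ (1 : Matrix (Fin M) (Fin M) ℝ)) * (1 - Me * Rblk)) :
    spectralRadius ℂ (B.map Complex.ofReal) < 1 ∧
    ∀ x0 : Fin N × Fin M → ℝ,
      Filter.Tendsto (fun i => (B ^ i).mulVec x0) Filter.atTop (nhds 0) := by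
  have hBv (v : Fin N × Fin M → ℂ) (k : Fin N) :
      (fun i => (B.map Complex.ofReal *ᵥ v) (k, i)) =
        ∑ l, (A l k : ℂ) • ((1 - μ l • R l).map Complex.ofReal *ᵥ fun j => v (l, j)) := by
    rw [hB, hMe]
    exact diffusion_mulVec A R μ hRblk v k
  have hcontract (l : Fin N) (hl : l ∈ S) {v : Fin M → ℂ} (hv : v ≠ 0) :
      ‖WithLp.toLp 2 ((1 - μ l • R l).map Complex.ofReal *ᵥ v)‖ < ‖WithLp.toLp 2 v‖ := by
    refine norm_toLp_map_ofReal_mulVec_lt (fun a ha =>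
      (hR l).isHermitian.sum_sq_one_sub_smul_mulVec_lt (fun i => ?_) ha) hv
    obtain ⟨hμ0, hμ2⟩ := hμS l hl
    have hi0 := (hR l).eigenvalues_pos i
    have hile := (hlam l).2 ((hR l).isHermitian.eigenvalues_mem_spectrum_real i)
    rw [lt_div_iff₀ (hi0.trans_le hile)] at hμ2
    have h1 := mul_pos hμ0 hi0
    have h2 := mul_le_mul_of_nonneg_left hile hμ0.le
    rw [abs_lt]
    constructor <;> linarith
  have hnonexp (l : Fin N) (v : Fin M → ℂ) :
      ‖WithLp.toLp 2 ((1 - μ l • R l).map Complex.ofReal *ᵥ v)‖ ≤ ‖WithLp.toLp 2 v‖ := by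
    by_cases hl : l ∈ S
    · rcases eq_or_ne v 0 with rfl | hv
      · simp
      · exact (hcontract l hl hv).le
    · rw [hμSc l hl, zero_smul, sub_zero, Matrix.map_one _ Complex.ofReal_zero Complex.ofReal_one,
        one_mulVec]
  obtain ⟨s, hs⟩ := hS
  have hspec : ∀ z ∈ spectrum ℂ (B.map Complex.ofReal), ‖z‖ < 1 := by
    intro z hz
    by_contra! hz1
    rw [spectrum.mem_iff, isUnit_iff_isUnit_det, isUnit_iff_ne_zero, not_not,
      ← exists_mulVec_eq_zero_iff] at hz
    obtain ⟨v, hv0, hv⟩ := hz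
    rw [sub_mulVec, sub_eq_zero, Algebra.algebraMap_eq_smul_one, smul_mulVec, one_mulVec] at hv
    have hzero := eq_zero_of_le_vecMul_of_primitive hA_nonneg hA_col hA_prim
      (x := fun k => ‖WithLp.toLp 2 fun i => v (k, i)‖)
      (d := fun k => ‖WithLp.toLp 2
        ((1 - μ k • R k).map Complex.ofReal *ᵥ fun i => v (k, i))‖)
      (s := s) (fun k => hnonexp k _) ?_ ?_
    · refine hv0 (funext fun ⟨k, i⟩ => ?_)
      have h := norm_eq_zero.1 (congrFun hzero k)
      exact congrFun (congrArg WithLp.ofLp h) i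
    · intro k
      have hk : z • WithLp.toLp 2 (fun i => v (k, i)) = ∑ l, (A l k : ℂ) • WithLp.toLp 2
          ((1 - μ l • R l).map Complex.ofReal *ᵥ fun j => v (l, j)) := by
        have h := congrArg (WithLp.toLp 2) (hBv v k)
        rw [← hv, WithLp.toLp_sum] at h
        exact h
      calc ‖WithLp.toLp 2 fun i => v (k, i)‖
          ≤ ‖z‖ * ‖WithLp.toLp 2 fun i => v (k, i)‖ := le_mul_of_one_le_left (norm_nonneg _) hz1
        _ = ‖∑ l, (A l k : ℂ) • WithLp.toLp 2
              ((1 - μ l • R l).map Complex.ofReal *ᵥ fun j => v (l, j))‖ := by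
            rw [← hk, norm_smul]
        _ ≤ _ := norm_sum_le _ _
        _ = _ := Finset.sum_congr rfl fun l _ => by
            rw [norm_smul, Complex.norm_real, Real.norm_of_nonneg (hA_nonneg l k), mul_comm]
    · exact fun hne => hcontract s hs fun h => hne (by simp [h])
  obtain ⟨i₀⟩ : Nonempty (Fin M) := by
    by_contra hM
    rw [not_nonempty_iff] at hM
    exact (hlam s).1 (isUnit_of_subsingleton _)
  have : Nonempty (Fin N × Fin M) := ⟨(s, i₀)⟩
  let : NormedRing (Matrix (Fin N × Fin M) (Fin N × Fin M) ℂ) := Matrix.linftyOpNormedRing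
  let : NormedAlgebra ℂ (Matrix (Fin N × Fin M) (Fin N × Fin M) ℂ) := Matrix.linftyOpNormedAlgebra
  have : CompleteSpace (Matrix (Fin N × Fin M) (Fin N × Fin M) ℂ) := FiniteDimensional.complete ℂ _
  have hrad : spectralRadius ℂ (B.map Complex.ofReal) < 1 := by
    exact_mod_cast spectrum.spectralRadius_lt_of_forall_lt (B.map Complex.ofReal) (r := 1) hspec
  refine ⟨hrad, fun x0 => ?_⟩
  have hpow (q : ℕ) : (B.map Complex.ofReal ^ q).map Complex.re = B ^ q := by
    have h : (B ^ q).map Complex.ofReal = B.map Complex.ofReal ^ q :=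
      map_pow Complex.ofRealHom.mapMatrix B q
    rw [← h]
    ext
    simp
  have hcont : Continuous fun X : Matrix (Fin N × Fin M) (Fin N × Fin M) ℂ =>
      X.map Complex.re *ᵥ x0 :=
    (continuous_id.matrix_map Complex.continuous_re).matrix_mulVec continuous_const
  have hlim := (hcont.tendsto 0).comp (tendsto_pow_zero_of_spectralRadius_lt_one hrad)
  simpa [Function.comp_def, hpow] using hlim
end

section
/- Let A be an N×N left-stochastic primitive matrix with right Perron eigenvector c (that is, A c = c, the entries of c are strictly positive, and they sum to 1). Let R_u be an M×M symmetric positive-definite matrix, and let z_1, …, z_N ∈ ℝ^M. For μ > 0 with 0 < μ < 2/λ_max(R_u), let B(μ) = (Aᵀ ⊗ I_M)(I_{NM} − μ (I_N ⊗ R_u)), so that I_{NM} − B(μ) is invertible, and let w̄(μ) ∈ ℝ^{NM} be the unique fixed point of the affine map x ↦ B(μ) x + μ (Aᵀ ⊗ I_M)(I_N ⊗ R_u) z, where z = col{z_1, …, z_N} ∈ ℝ^{NM}. Then as μ → 0⁺, each M-dimensional block w̄_k(μ) of w̄(μ) converges to the same vector Σ_{k=1}^N c_k z_k. -/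
open Matrix Kronecker

theorem norm_mulVec_le_of_rowStochastic {ι : Type*} [Fintype ι] {P : Matrix ι ι ℝ}
    (hP : ∀ i j, 0 ≤ P i j) (hP1 : ∀ i, ∑ j, P i j = 1) (y : ι → ℝ) :
    ‖P *ᵥ y‖ ≤ ‖y‖ := by
  refine (pi_norm_le_iff_of_nonneg (norm_nonneg y)).2 fun i => ?_
  calc ‖∑ j, P i j * y j‖ ≤ ∑ j, ‖P i j * y j‖ := norm_sum_le _ _
    _ ≤ ∑ j, P i j * ‖y‖ := by
        refine Finset.sum_le_sum fun j _ => ?_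
        rw [norm_mul, Real.norm_of_nonneg (hP i j)]
        exact mul_le_mul_of_nonneg_left (norm_le_pi_norm y j) (hP i j)
    _ = ‖y‖ := by rw [← Finset.sum_mul, hP1, one_mul]

/-- A fixed vector of a primitive row-stochastic matrix is constant. -/
theorem apply_eq_of_mulVec_eq_of_primitive {ι : Type*} [Fintype ι] [DecidableEq ι]
    {P : Matrix ι ι ℝ} (hP1 : ∀ i, ∑ j, P i j = 1) {n : ℕ} (hpos : ∀ k l, 0 < (P ^ n) k l)
    {w : ι → ℝ} (hw : P *ᵥ w = w) (k l : ι) : w k = w l := by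
  have hpow {v : ι → ℝ} (hv : P *ᵥ v = v) : ∀ m : ℕ, (P ^ m) *ᵥ v = v := by
    intro m
    induction m with
    | zero => simp
    | succ m ih => rw [pow_succ, ← mulVec_mulVec, hv, ih]
  have hone : P *ᵥ (fun _ => (1 : ℝ)) = fun _ => 1 := by
    ext i
    simp [mulVec, dotProduct, hP1]
  have : Nonempty ι := ⟨k⟩
  obtain ⟨m, hm⟩ := Finite.exists_max w
  suffices h : ∀ i, w i = w m by rw [h k, h l]
  have h1 : ∑ i, (P ^ n) m i * w i = w m := congrFun (hpow hw n) m
  have h2 : ∑ i, (P ^ n) m i = 1 := by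
    simpa [mulVec, dotProduct] using congrFun (hpow hone n) m
  have h3 : ∑ i, (P ^ n) m i * (w m - w i) = 0 := by
    simp only [mul_sub, Finset.sum_sub_distrib, h1, ← Finset.sum_mul, h2]
    ring
  intro i
  have h4 := (Finset.sum_eq_zero_iff_of_nonneg fun i _ =>
    mul_nonneg (hpos m i).le (sub_nonneg.2 (hm i))).1 h3 i (Finset.mem_univ i)
  rcases mul_eq_zero.1 h4 with h | h
  · exact absurd h (hpos m i).ne'
  · linarith

theorem isUnit_one_sub_add_vecMulVec_of_primitive {ι : Type*} [Fintype ι] [DecidableEq ι]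
    {P : Matrix ι ι ℝ} (hP1 : ∀ i, ∑ j, P i j = 1) {n : ℕ} (hpos : ∀ k l, 0 < (P ^ n) k l)
    {c : ι → ℝ} (hc : c ᵥ* P = c) (hc1 : ∑ k, c k = 1) :
    IsUnit (1 - P + vecMulVec (fun _ => 1) c) := by
  rw [← mulVec_injective_iff_isUnit]
  refine (injective_iff_map_eq_zero (mulVecLin (1 - P + vecMulVec (fun _ => 1) c))).2 ?_
  intro w hw
  rw [mulVecLin_apply, add_mulVec, sub_mulVec, one_mulVec, vecMulVec_mulVec] at hw
  have hcw : c ⬝ᵥ w = 0 := by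
    have h := congrArg (c ⬝ᵥ ·) hw
    simp only [dotProduct_add, dotProduct_sub, dotProduct_mulVec, hc, dotProduct_zero,
      sub_self, zero_add] at h
    simpa [dotProduct, ← Finset.sum_mul, hc1] using h
  have hPw : P *ᵥ w = w := by
    rw [hcw] at hw
    simpa [sub_eq_zero, eq_comm] using hw
  ext k
  have h : c ⬝ᵥ w = w k := by
    simp [dotProduct, apply_eq_of_mulVec_eq_of_primitive hP1 hpos hPw _ k, ← Finset.sum_mul, hc1]
  rw [← h, hcw, Pi.zero_apply]

theorem eq_zero_of_eq_smul_mulVec_of_rowStochastic {ι : Type*} [Fintype ι] {P : Matrix ι ι ℝ}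
    (hP : ∀ i j, 0 ≤ P i j) (hP1 : ∀ i, ∑ j, P i j = 1) {t : ℝ} (ht : |t| < 1) {y : ι → ℝ}
    (hy : y = t • P *ᵥ y) : y = 0 := by
  have h1 : ‖y‖ ≤ |t| * ‖y‖ := by
    conv_lhs => rw [hy, norm_smul, Real.norm_eq_abs]
    exact mul_le_mul_of_nonneg_left (norm_mulVec_le_of_rowStochastic hP hP1 y) (abs_nonneg t)
  rw [← norm_eq_zero]
  nlinarith [norm_nonneg y]

/-- As `t → 0⁺`, the fixed point of `y ↦ (1 - t) P y + t P ζ` tends to the constant vector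
whose value is the mean of `ζ` under the stationary distribution `c` of `P`. -/
theorem tendsto_fixedPoint_of_primitive {ι : Type*} [Fintype ι] [DecidableEq ι]
    {P : Matrix ι ι ℝ} (hP : ∀ i j, 0 ≤ P i j) (hP1 : ∀ i, ∑ j, P i j = 1) {n : ℕ}
    (hpos : ∀ k l, 0 < (P ^ n) k l) {c : ι → ℝ} (hc : c ᵥ* P = c) (hc1 : ∑ k, c k = 1)
    (ζ : ι → ℝ) {α : Type*} {l : Filter α} {t : α → ℝ}
    (ht : Filter.Tendsto t l (nhdsWithin 0 (Set.Ioi 0))) {y : α → ι → ℝ}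
    (hy : ∀ᶠ a in l, y a = (1 - t a) • P *ᵥ y a + t a • P *ᵥ ζ) :
    Filter.Tendsto y l (nhds fun _ => c ⬝ᵥ ζ) := by
  set Q : Matrix ι ι ℝ := 1 - P + vecMulVec (fun _ => 1) c with hQ
  have hQu : IsUnit Q := isUnit_one_sub_add_vecMulVec_of_primitive hP1 hpos hc hc1
  have ht0 : Filter.Tendsto t l (nhds 0) := ht.mono_right nhdsWithin_le_nhds
  have ht_pos : ∀ᶠ a in l, 0 < t a := ht self_mem_nhdsWithin
  have ht_one : ∀ᶠ a in l, t a < 1 := ht0.eventually_lt_const one_pos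
  have hone : P *ᵥ (fun _ => c ⬝ᵥ ζ) = fun _ => c ⬝ᵥ ζ := by
    ext i
    simp [mulVec, dotProduct, ← Finset.sum_mul, hP1]
  have hbound : ∀ᶠ a in l, ‖Q *ᵥ (y a - fun _ => c ⬝ᵥ ζ)‖ ≤ 2 * ‖ζ‖ * t a := by
    filter_upwards [hy, ht_pos, ht_one] with a hya h0 h1
    have hPy := norm_mulVec_le_of_rowStochastic hP hP1 (y a)
    have hPζ := norm_mulVec_le_of_rowStochastic hP hP1 ζ
    have hle : ‖y a‖ ≤ (1 - t a) * ‖P *ᵥ y a‖ + t a * ‖P *ᵥ ζ‖ := by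
      conv_lhs => rw [hya]
      refine (norm_add_le _ _).trans_eq ?_
      rw [norm_smul, norm_smul, Real.norm_of_nonneg h0.le, Real.norm_of_nonneg (by linarith)]
    have hyζ : ‖y a‖ ≤ ‖ζ‖ := by
      have : t a * ‖y a‖ ≤ t a * ‖ζ‖ := by nlinarith
      exact le_of_mul_le_mul_left this h0
    have hcy : c ⬝ᵥ y a = c ⬝ᵥ ζ := by
      have h := congrArg (c ⬝ᵥ ·) hya
      simp only [dotProduct_add, dotProduct_smul, dotProduct_mulVec, hc, smul_eq_mul] at h
      have : t a * (c ⬝ᵥ y a) = t a * (c ⬝ᵥ ζ) := by linarith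
      exact mul_left_cancel₀ h0.ne' this
    have hmean : c ⬝ᵥ (fun _ => c ⬝ᵥ ζ) = c ⬝ᵥ ζ := by
      rw [dotProduct, ← Finset.sum_mul, hc1, one_mul]
    have hQy : Q *ᵥ (y a - fun _ => c ⬝ᵥ ζ) = t a • (P *ᵥ ζ - P *ᵥ y a) := by
      rw [hQ, add_mulVec, sub_mulVec, one_mulVec, vecMulVec_mulVec, mulVec_sub, hone,
        dotProduct_sub, hcy, hmean, sub_self]
      ext i
      have hi := congrFun hya i
      simp only [Pi.add_apply, Pi.sub_apply, Pi.smul_apply, smul_eq_mul, MulOpposite.op_zero,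
        zero_smul, Pi.zero_apply, add_zero] at hi ⊢
      linarith
    rw [hQy, norm_smul, Real.norm_of_nonneg h0.le]
    have := norm_sub_le (P *ᵥ ζ) (P *ᵥ y a)
    nlinarith
  have hlim : Filter.Tendsto (fun a => Q *ᵥ (y a - fun _ => c ⬝ᵥ ζ)) l (nhds 0) :=
    squeeze_zero_norm' hbound (by simpa using ht0.const_mul (2 * ‖ζ‖))
  have hinv : Filter.Tendsto (fun a => Q⁻¹ *ᵥ (Q *ᵥ (y a - fun _ => c ⬝ᵥ ζ))) l (nhds 0) := by
    have hcont : Continuous fun v : ι → ℝ => Q⁻¹ *ᵥ v := by fun_prop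
    have h0 := hcont.tendsto 0
    rw [mulVec_zero] at h0
    exact h0.comp hlim
  have hQQ : Q⁻¹ * Q = 1 := nonsing_inv_mul Q ((isUnit_iff_isUnit_det Q).1 hQu)
  simp only [mulVec_mulVec, hQQ, one_mulVec] at hinv
  simpa using hinv.add_const fun _ => c ⬝ᵥ ζ

theorem exists_eigenvector_expansion {κ : Type*} [Fintype κ] [DecidableEq κ]
    {R : Matrix κ κ ℝ} (hR : R.PosDef) {lamMax : ℝ} (hlam : lamMax ∈ upperBounds (spectrum ℝ R)) :
    ∃ (v : κ → κ → ℝ) (lam : κ → ℝ), (∀ j, 0 < lam j ∧ lam j ≤ lamMax) ∧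
      (∀ j, v j ᵥ* R = lam j • v j) ∧ ∀ x : κ → ℝ, x = fun i => ∑ j, v j i * (v j ⬝ᵥ x) := by
  refine ⟨fun j => (hR.1.eigenvectorBasis j).ofLp, hR.1.eigenvalues,
    fun j => ⟨hR.eigenvalues_pos j, hlam (hR.1.eigenvalues_mem_spectrum_real j)⟩, fun j => ?_,
    fun x => ?_⟩
  · have h : Rᵀ = R := by simpa using hR.1.eq
    rw [← mulVec_transpose, h, hR.1.mulVec_eigenvectorBasis]
  · ext i
    have h := congrArg (fun e : EuclideanSpace ℝ κ => e i)
      (hR.1.eigenvectorBasis.sum_repr' (WithLp.toLp 2 x))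
    simpa [EuclideanSpace.inner_eq_star_dotProduct, mul_comm, dotProduct_comm] using h.symm

/-- Contraction of the second index of `x` against `v`. -/
def blockDot {ι κ : Type*} [Fintype κ] (v : κ → ℝ) (x : ι × κ → ℝ) : ι → ℝ :=
  fun k => v ⬝ᵥ fun i => x (k, i)

section blockDot

variable {ι κ : Type*} [Fintype κ]

theorem blockDot_add (v : κ → ℝ) (x y : ι × κ → ℝ) :
    blockDot v (x + y) = blockDot v x + blockDot v y := by
  ext k
  exact dotProduct_add _ _ _

theorem blockDot_sub (v : κ → ℝ) (x y : ι × κ → ℝ) :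
    blockDot v (x - y) = blockDot v x - blockDot v y := by
  ext k
  exact dotProduct_sub _ _ _

theorem blockDot_smul (v : κ → ℝ) (a : ℝ) (x : ι × κ → ℝ) :
    blockDot v (a • x) = a • blockDot v x := by
  ext k
  exact dotProduct_smul _ _ _

theorem blockDot_kronecker_one [Fintype ι] [DecidableEq κ] (v : κ → ℝ) (P : Matrix ι ι ℝ)
    (x : ι × κ → ℝ) :
    blockDot v ((P ⊗ₖ (1 : Matrix κ κ ℝ)) *ᵥ x) = P *ᵥ blockDot v x := by
  ext k
  simp only [blockDot, mulVec, dotProduct, kroneckerMap_apply, Fintype.sum_prod_type, one_apply,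
    mul_ite, mul_one, mul_zero, ite_mul, zero_mul, Finset.sum_ite_eq, Finset.mem_univ, if_true,
    Finset.mul_sum]
  rw [Finset.sum_comm]
  exact Finset.sum_congr rfl fun _ _ => Finset.sum_congr rfl fun _ _ => by ring

theorem blockDot_one_kronecker [Fintype ι] [DecidableEq ι] (v : κ → ℝ) (R : Matrix κ κ ℝ)
    (x : ι × κ → ℝ) :
    blockDot v (((1 : Matrix ι ι ℝ) ⊗ₖ R) *ᵥ x) = blockDot (v ᵥ* R) x := by
  ext k
  have h : (fun i => (((1 : Matrix ι ι ℝ) ⊗ₖ R) *ᵥ x) (k, i)) = R *ᵥ fun i => x (k, i) := by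
    ext i
    simp [mulVec, dotProduct, kroneckerMap_apply, Fintype.sum_prod_type_right, one_apply]
  rw [blockDot, h, dotProduct_mulVec, blockDot]

theorem blockDot_smul_left (v : κ → ℝ) (a : ℝ) (x : ι × κ → ℝ) :
    blockDot (a • v) x = a • blockDot v x := by
  ext k
  exact smul_dotProduct _ _ _

end blockDot

/-- Let `A` be an `N×N` left-stochastic primitive matrix with right
Perron eigenvector `c` (`Ac = c`, entries positive, summing to 1), `R_u` an `M×M`
symmetric positive-definite matrix with largest eigenvalue `lamMax`, and
`z_1, …, z_N ∈ ℝ^M`. For `0 < μ < 2/lamMax`, with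
`B(μ) = (Aᵀ ⊗ I_M)(I_{NM} - μ (I_N ⊗ R_u))`, the matrix `I_{NM} - B(μ)` is
invertible, and the unique fixed point `w̄(μ)` of
`x ↦ B(μ) x + μ (Aᵀ ⊗ I_M)(I_N ⊗ R_u) z` (with `z = col{z_1, …, z_N}`) has every
`M`-dimensional block converging, as `μ → 0⁺`, to the same vector `Σ_k c_k z_k`. -/
theorem stmt_7 (N M : ℕ) (A : Matrix (Fin N) (Fin N) ℝ)
    (hA_nonneg : ∀ i j, 0 ≤ A i j)
    (hA_col : ∀ j, ∑ i, A i j = 1)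
    (hA_prim : ∃ j : ℕ, 0 < j ∧ ∀ k l, 0 < (A ^ j) k l)
    (c : Fin N → ℝ) (hc1 : A.mulVec c = c) (hc2 : ∀ k, 0 < c k) (hc3 : ∑ k, c k = 1)
    (Ru : Matrix (Fin M) (Fin M) ℝ) (hRu : Ru.PosDef)
    (lamMax : ℝ) (hlam : IsGreatest (spectrum ℝ Ru) lamMax)
    (z : Fin N → Fin M → ℝ)
    (zvec : Fin N × Fin M → ℝ) (hz : ∀ k i, zvec (k, i) = z k i)
    (B : ℝ → Matrix (Fin N × Fin M) (Fin N × Fin M) ℝ)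
    (hB : ∀ μ : ℝ, B μ = (Aᵀ ⊗ₖ (1 : Matrix (Fin M) (Fin M) ℝ)) *
      (1 - μ • ((1 : Matrix (Fin N) (Fin N) ℝ) ⊗ₖ Ru)))
    (wbar : ℝ → (Fin N × Fin M → ℝ))
    (hwbar : ∀ μ : ℝ, 0 < μ → μ < 2 / lamMax →
      wbar μ = (B μ).mulVec (wbar μ) +
        μ • ((Aᵀ ⊗ₖ (1 : Matrix (Fin M) (Fin M) ℝ)) *
          ((1 : Matrix (Fin N) (Fin N) ℝ) ⊗ₖ Ru)).mulVec zvec) :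
    (∀ μ : ℝ, 0 < μ → μ < 2 / lamMax →
      IsUnit ((1 : Matrix (Fin N × Fin M) (Fin N × Fin M) ℝ) - B μ)) ∧
    (∀ k : Fin N,
      Filter.Tendsto (fun μ : ℝ => fun i : Fin M => wbar μ (k, i))
        (nhdsWithin 0 (Set.Ioi 0)) (nhds (∑ l, c l • z l))) := by
  obtain ⟨n, -, hn⟩ := hA_prim
  have hP : ∀ i j, 0 ≤ Aᵀ i j := fun i j => hA_nonneg j i
  have hpos : ∀ k l, 0 < (Aᵀ ^ n) k l := fun k l => by
    rw [← transpose_pow]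
    exact hn l k
  have hcP : c ᵥ* Aᵀ = c := by rw [vecMul_transpose, hc1]
  obtain ⟨v, lam, hlam_bd, hv, hexp⟩ := exists_eigenvector_expansion hRu hlam.2
  have hBdot (μ : ℝ) (x : Fin N × Fin M → ℝ) (j : Fin M) :
      blockDot (v j) (B μ *ᵥ x) = (1 - μ * lam j) • Aᵀ *ᵥ blockDot (v j) x := by
    rw [hB, ← mulVec_mulVec, blockDot_kronecker_one, sub_mulVec, one_mulVec, smul_mulVec,
      blockDot_sub, blockDot_smul, blockDot_one_kronecker, hv, blockDot_smul_left, smul_smul,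
      mulVec_sub, mulVec_smul, sub_smul, one_smul]
  refine ⟨fun μ hμ hμ2 => ?_, fun k => ?_⟩
  · rw [← mulVec_injective_iff_isUnit]
    refine (injective_iff_map_eq_zero (mulVecLin (1 - B μ))).2 fun x hx => ?_
    rw [mulVecLin_apply, sub_mulVec, one_mulVec, sub_eq_zero] at hx
    have hzero (j : Fin M) : blockDot (v j) x = 0 := by
      obtain ⟨h0, h1⟩ := hlam_bd j
      have h2 : μ * lamMax < 2 := (lt_div_iff₀ (h0.trans_le h1)).1 hμ2
      refine eq_zero_of_eq_smul_mulVec_of_rowStochastic (t := 1 - μ * lam j) hP hA_col ?_ ?_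
      · rw [abs_lt]
        constructor <;> nlinarith [mul_pos hμ h0]
      · rw [← hBdot, ← hx]
    ext ⟨k, i⟩
    have h := congrFun (hexp fun i => x (k, i)) i
    have h0 (j : Fin M) : (v j ⬝ᵥ fun i => x (k, i)) = 0 := congrFun (hzero j) k
    simpa [h0] using h
  · have hlim (j : Fin M) : Filter.Tendsto (fun μ => blockDot (v j) (wbar μ))
        (nhdsWithin 0 (Set.Ioi 0)) (nhds fun _ => c ⬝ᵥ blockDot (v j) zvec) := by
      obtain ⟨h0, h1⟩ := hlam_bd j
      refine tendsto_fixedPoint_of_primitive (t := fun μ => μ * lam j) hP hA_col hpos hcP hc3 _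
        (tendsto_nhdsWithin_iff.2 ⟨?_, ?_⟩) ?_
      · have h : Filter.Tendsto (fun μ : ℝ => μ * lam j) (nhds 0) (nhds (0 * lam j)) :=
          Filter.tendsto_id.mul_const _
        rw [zero_mul] at h
        exact h.mono_left nhdsWithin_le_nhds
      · filter_upwards [self_mem_nhdsWithin] with μ hμ
        exact mul_pos hμ h0
      · filter_upwards [Ioo_mem_nhdsGT (div_pos two_pos (h0.trans_le h1))] with μ hμ
        conv_lhs => rw [hwbar μ hμ.1 hμ.2]
        rw [blockDot_add, hBdot, blockDot_smul, ← mulVec_mulVec, blockDot_kronecker_one,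
          blockDot_one_kronecker, hv, blockDot_smul_left, mulVec_smul, smul_smul]
    rw [tendsto_pi_nhds]
    intro i
    have hw (μ : ℝ) : wbar μ (k, i) = ∑ j, v j i * blockDot (v j) (wbar μ) k :=
      congrFun (hexp fun i => wbar μ (k, i)) i
    have hsum : (∑ l, c l • z l) i = ∑ j, v j i * (c ⬝ᵥ blockDot (v j) zvec) := by
      have hcz (j : Fin M) : c ⬝ᵥ blockDot (v j) zvec = v j ⬝ᵥ ∑ l, c l • z l := by
        simp only [dotProduct_sum, dotProduct_smul, smul_eq_mul]
        exact Finset.sum_congr rfl fun l _ => by simp only [blockDot, hz]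
      simp only [hcz]
      exact congrFun (hexp _) i
    simp only [hw, hsum]
    exact tendsto_finsetSum _ fun j _ => ((tendsto_pi_nhds.1 (hlim j)) k).const_mul _
end

section
/- Let V be a real inner product space and let h, x, y ∈ V satisfy ‖x − h‖² + ‖y − h‖² < ‖h‖². Then ⟨x, y⟩ > 0. -/
open scoped RealInnerProductSpace

theorem two_mul_inner_eq_norm_sq_add_sub {V : Type*} [NormedAddCommGroup V]
    [InnerProductSpace ℝ V] (h x y : V) :
    2 * ⟪x, y⟫ = ‖x + y - h‖ ^ 2 + ‖h‖ ^ 2 - (‖x - h‖ ^ 2 + ‖y - h‖ ^ 2) := by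
  simp only [norm_sub_sq_real, norm_add_sq_real, inner_add_left]
  ring

/-- In a real inner product space, if
`‖x - h‖² + ‖y - h‖² < ‖h‖²`, then `⟪x, y⟫ > 0`. -/
theorem stmt_10 {V : Type*} [NormedAddCommGroup V] [InnerProductSpace ℝ V]
    (h x y : V) (hyp : ‖x - h‖ ^ 2 + ‖y - h‖ ^ 2 < ‖h‖ ^ 2) :
    0 < ⟪x, y⟫ := by
  linarith [two_mul_inner_eq_norm_sq_add_sub h x y, sq_nonneg ‖x + y - h‖]
end

section
/- Let G be a connected simple graph on the vertex set {1, …, N} with N ≥ 2, and for each vertex k let 𝒩_k = {k} ∪ {neighbors of k} be its closed neighborhood, with n_k = |𝒩_k|. Let I ⊆ {1, …, N} be a nonempty set of informed vertices, and for each k set 𝒩_k^f = 𝒩_k ∩ I with n_k^f = |𝒩_k^f|. Define the N×N matrix A by: if n_k^f > 0 then a_{l,k} = 1/n_k^f for l ∈ 𝒩_k^f and a_{l,k} = 0 otherwise; and if n_k^f = 0 then a_{l,k} = 1/(n_k − 1) for l ∈ 𝒩_k with l ≠ k and a_{l,k} = 0 otherwise. Then for every vertex k there exist an informed vertex l ∈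 I and an integer j ≥ 1 such that (A^j)_{l,k} > 0. -/
theorem Matrix.pow_succ_apply_pos {n : Type*} [Fintype n] [DecidableEq n] {A : Matrix n n ℝ}
    (hA : ∀ i j, 0 ≤ A i j) {j : ℕ} {l v k : n} (h₁ : 0 < (A ^ j) l v) (h₂ : 0 < A v k) :
    0 < (A ^ (j + 1)) l k := by
  have hpow (m : ℕ) : ∀ i i', 0 ≤ (A ^ m) i i' := by
    induction m with
    | zero =>
      intro i i'
      rw [pow_zero, Matrix.one_apply]
      split_ifs <;> norm_num
    | succ m ih =>
      intro i i'
      rw [pow_succ, Matrix.mul_apply]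
      exact Finset.sum_nonneg fun x _ => mul_nonneg (ih _ _) (hA _ _)
  rw [pow_succ, Matrix.mul_apply]
  exact Finset.sum_pos' (fun x _ => mul_nonneg (hpow _ _ _) (hA _ _))
    ⟨v, Finset.mem_univ v, mul_pos h₁ h₂⟩

/-- Let `G` be a connected simple graph on `{1, …, N}` (`N ≥ 2`), with
closed neighborhoods `𝒩_k` of sizes `n_k`, and let `I` be a nonempty set of informed
vertices, with `𝒩_k^f = 𝒩_k ∩ I` of size `n_k^f`. Define `A` column-wise by: if
`n_k^f > 0` then `a_{l,k} = 1/n_k^f` for `l ∈ 𝒩_k^f` (else 0); if `n_k^f = 0` then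
`a_{l,k} = 1/(n_k - 1)` for `l ∈ 𝒩_k, l ≠ k` (else 0). Then every vertex `k` admits
an informed vertex `l ∈ I` and an integer `j ≥ 1` with `(A^j)_{l,k} > 0`. -/
theorem stmt_16 (N : ℕ) (hN : 2 ≤ N) (G : SimpleGraph (Fin N)) [DecidableRel G.Adj]
    (hconn : G.Connected) (I : Finset (Fin N)) (hI : I.Nonempty)
    (A : Matrix (Fin N) (Fin N) ℝ)
    (hA : ∀ k l : Fin N,
      A l k =
        if ((insert k (G.neighborFinset k)) ∩ I).Nonempty then
          (if l ∈ (insert k (G.neighborFinset k)) ∩ I then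
            1 / (((insert k (G.neighborFinset k)) ∩ I).card : ℝ) else 0)
        else
          (if l ∈ insert k (G.neighborFinset k) ∧ l ≠ k then
            1 / (((insert k (G.neighborFinset k)).card : ℝ) - 1) else 0)) :
    ∀ k : Fin N, ∃ l ∈ I, ∃ j : ℕ, 1 ≤ j ∧ 0 < (A ^ j) l k := by
  have hnonneg (l k : Fin N) : 0 ≤ A l k := by
    have hcard : (1 : ℝ) ≤ ((insert k (G.neighborFinset k)).card : ℝ) := by
      exact_mod_cast (Finset.insert_nonempty k (G.neighborFinset k)).card_pos
    rw [hA]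
    split_ifs
    · positivity
    · exact le_rfl
    · exact one_div_nonneg.2 (sub_nonneg.2 hcard)
    · exact le_rfl
  have informed_neighbor (k : Fin N) (hk : ((insert k (G.neighborFinset k)) ∩ I).Nonempty) :
      ∃ l ∈ I, ∃ j : ℕ, 1 ≤ j ∧ 0 < (A ^ j) l k := by
    obtain ⟨l, hl⟩ := hk
    refine ⟨l, (Finset.mem_inter.1 hl).2, 1, le_rfl, ?_⟩
    rw [pow_one, hA, if_pos ⟨l, hl⟩, if_pos hl]
    exact one_div_pos.2 (Nat.cast_pos.2 (Finset.card_pos.2 ⟨l, hl⟩))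
  obtain ⟨t, ht⟩ := hI
  intro k
  obtain ⟨p⟩ := hconn.preconnected k t
  induction p with
  | nil => exact informed_neighbor _ ⟨_, Finset.mem_inter.2 ⟨Finset.mem_insert_self _ _, ht⟩⟩
  | @cons k v _ hadj _ ih =>
    by_cases hk : ((insert k (G.neighborFinset k)) ∩ I).Nonempty
    · exact informed_neighbor k hk
    obtain ⟨l, hl, j, -, hpos⟩ := ih ht
    refine ⟨l, hl, j + 1, Nat.le_add_left 1 j, Matrix.pow_succ_apply_pos hnonneg hpos ?_⟩
    have hv : v ∈ G.neighborFinset k := (G.mem_neighborFinset k v).2 hadj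
    rw [hA, if_neg hk, if_pos ⟨Finset.mem_insert_of_mem hv, hadj.ne'⟩,
      Finset.card_insert_of_notMem (by simp), Nat.cast_add, Nat.cast_one, add_sub_cancel_right]
    exact one_div_pos.2 (Nat.cast_pos.2 (Finset.card_pos.2 ⟨v, hv⟩))
end
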